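/- arXiv:2205.14602 — 2 statements merged into one kernel-verified Lean document; each statement's English description precedes it below -/
import Mathlib

section
/- Let 0 < q, r < ∞ and 1 < p < ∞ with max{q, r} < p, let u, w be weights on (0,∞), and let v be a weight on (0,∞) such that ∫₀^x v(t)^{1-p'} dt < ∞ for every x ∈ (0,∞). Then there exists a constant C > 0 such that (∫₀^∞ (∫_x^∞ (∫₀^t h(s) ds)^r u(t) dt)^{q/r} w(x) dx)^{1/q} ≤ C (∫₀^∞ h(t)^p v(t) dt)^{1/p} for all h ∈ M⁺(0,∞) if and only if F₄ < ∞ and F₆ < ∞, where F₄ := (∫₀^∞ (∫_x^∞ (∫_t^∞ u)^{q/r} w(t) dt)^{q/(p-q)} (∫_x^∞ u)^{q/r} (∫₀^x v^{1-p'})^{(p-1)q/(p-q)} w(x) dx)^{(p-q)/(pq)} and F₆ := (∫₀^∞ (∫₀^t w)^{q/(p-q)} w(t) (∫_t^∞ (∫_x^∞ u)^{r/(p-r)} u(x) (∫₀^x v^{1-p'})^{(p-1)r/(p-r)} dx)^{q(p-r)/(r(p-q))} dt)^{(p-q)/(pq)}. -/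
open MeasureTheory Set ENNReal NNReal

noncomputable section

/-- Lebesgue measure restricted to `(0, ∞)`. -/
def mu0 : Measure ℝ := volume.restrict (Ioi (0 : ℝ))

/-- A weight on `(0, ∞)`: a measurable function that is positive (and finite) a.e. on `(0, ∞)`. -/
def IsWeight (v : ℝ → ℝ≥0∞) : Prop :=
  Measurable v ∧ ∀ᵐ x ∂mu0, 0 < v x ∧ v x < ∞

open Filter Topology

theorem continuous_measure_Iic (ν : Measure ℝ) [IsFiniteMeasure ν] [NullSingletonClass ν] :
    Continuous fun y => ν (Iic y) := by
  rw [continuous_iff_continuousAt]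
  intro y₀
  have h : ∀ y, ν (Iic y) = ∫⁻ z, (Iic y).indicator (fun _ => (1 : ℝ≥0∞)) z ∂ν := fun y => by
    rw [lintegral_indicator measurableSet_Iic]; simp
  simp only [ContinuousAt, h]
  refine tendsto_lintegral_filter_of_dominated_convergence (fun _ => 1)
    (Eventually.of_forall fun y => measurable_const.indicator measurableSet_Iic)
    (Eventually.of_forall fun y => Eventually.of_forall fun z => ?_) (by simp) ?_
  · exact indicator_le_self' (by simp) z
  · have : ∀ᵐ z ∂ν, z ≠ y₀ := by simp [ae_iff, measure_singleton]
    filter_upwards [this] with z hz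
    refine tendsto_const_nhds.congr' ?_
    rcases lt_or_gt_of_ne hz with hz | hz
    · filter_upwards [lt_mem_nhds hz] with y hy
      rw [indicator_of_mem (mem_Iic.2 hz.le), indicator_of_mem (mem_Iic.2 hy.le)]
    · filter_upwards [gt_mem_nhds hz] with y hy
      rw [indicator_of_notMem (notMem_Iic.2 hz), indicator_of_notMem (notMem_Iic.2 hy)]

theorem map_toReal_measure_Iic (ν : Measure ℝ) [IsFiniteMeasure ν] [NullSingletonClass ν] :
    ν.map (fun y => (ν (Iic y)).toReal) = volume.restrict (Ioc 0 (ν univ).toReal) := by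
  set g : ℝ → ℝ := fun y => (ν (Iic y)).toReal with hg
  have hfin : ∀ s, ν s ≠ ∞ := fun s => measure_ne_top ν s
  have hgc : Continuous g :=
    continuous_iff_continuousAt.2 fun y => (ENNReal.tendsto_toReal (hfin _)).comp
      (continuous_measure_Iic ν).continuousAt
  have hgm : Monotone g := fun a b hab =>
    ENNReal.toReal_mono (hfin _) (measure_mono (Iic_subset_Iic.2 hab))
  have hg0 : ∀ y, 0 ≤ g y := fun y => ENNReal.toReal_nonneg
  have hgtop : Tendsto g atTop (𝓝 (ν univ).toReal) :=
    (ENNReal.tendsto_toReal (hfin _)).comp (tendsto_measure_Iic_atTop ν)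
  have hgbot : Tendsto (fun n : ℕ => g (-(n : ℝ))) atTop (𝓝 0) := by
    have h := tendsto_measure_iInter_atTop (μ := ν) (s := fun n : ℕ => Iic (-(n : ℝ)))
      (fun n => measurableSet_Iic.nullMeasurableSet)
      (fun a b hab => Iic_subset_Iic.2 (by simpa using hab)) ⟨0, hfin _⟩
    have h2 : ⋂ n : ℕ, Iic (-(n : ℝ)) = ∅ := by
      ext z
      simp only [mem_iInter, mem_Iic, mem_empty_iff_false, iff_false, not_forall, not_le]
      obtain ⟨n, hn⟩ := exists_nat_gt (-z)
      exact ⟨n, by linarith⟩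
    rw [h2, measure_empty] at h
    have h3 := (ENNReal.tendsto_toReal zero_ne_top).comp h
    rwa [toReal_zero] at h3
  refine Measure.ext_of_Iic _ _ fun t => ?_
  rw [Measure.map_apply hgc.measurable measurableSet_Iic, Measure.restrict_apply measurableSet_Iic]
  have hle : ∀ y, g y ≤ (ν univ).toReal := fun y => ENNReal.toReal_mono (hfin _)
    (measure_mono (subset_univ _))
  rcases lt_or_ge t 0 with ht | ht
  · have h1 : g ⁻¹' Iic t = ∅ := by
      ext y; simpa using ht.trans_le (hg0 y)
    have h2 : Iic t ∩ Ioc 0 (ν univ).toReal = ∅ := by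
      ext y; simp only [mem_inter_iff, mem_Iic, mem_Ioc, mem_empty_iff_false, iff_false]
      rintro ⟨h, h', -⟩; linarith
    rw [h1, h2, measure_empty, measure_empty]
  rcases le_or_gt (ν univ).toReal t with hT | hT
  · have h1 : g ⁻¹' Iic t = univ := by
      ext y; simpa using (hle y).trans hT
    have h2 : Iic t ∩ Ioc 0 (ν univ).toReal = Ioc 0 (ν univ).toReal :=
      inter_eq_right.2 fun y hy => hy.2.trans hT
    rw [h1, h2, Real.volume_Ioc, sub_zero, ENNReal.ofReal_toReal (hfin _)]
  have h2 : Iic t ∩ Ioc 0 (ν univ).toReal = Ioc 0 t := by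
    ext y; simp only [mem_inter_iff, mem_Iic, mem_Ioc]
    exact ⟨fun h => ⟨h.2.1, h.1⟩, fun h => ⟨h.2, h.1, h.2.trans hT.le⟩⟩
  rw [h2, Real.volume_Ioc, sub_zero]
  obtain ⟨y₁, hy₁⟩ : ∃ y₁, t < g y₁ := (hgtop.eventually (lt_mem_nhds hT)).exists
  rcases (g ⁻¹' Iic t).eq_empty_or_nonempty with hS | hS
  · have : t ≤ 0 := ge_of_tendsto hgbot (Eventually.of_forall fun n => by
      by_contra hlt
      have : -(n : ℝ) ∈ g ⁻¹' Iic t := (not_le.1 hlt).le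
      rw [hS] at this; exact this)
    rw [hS, measure_empty, le_antisymm this ht, ENNReal.ofReal_zero]
  · have hbdd : BddAbove (g ⁻¹' Iic t) := ⟨y₁, fun y hy => by
      by_contra hlt
      exact absurd (hgm (not_le.1 hlt).le) (not_le.2 (lt_of_le_of_lt hy hy₁))⟩
    set z := sSup (g ⁻¹' Iic t)
    have hz : z ∈ g ⁻¹' Iic t := (isClosed_Iic.preimage hgc).csSup_mem hS hbdd
    have hSz : g ⁻¹' Iic t = Iic z := by
      ext y; exact ⟨fun hy => le_csSup hbdd hy, fun hy => (hgm hy).trans hz⟩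
    have hzt : g z = t := by
      refine le_antisymm hz ?_
      by_contra hlt
      have hzy : z ≤ y₁ := by
        by_contra h
        exact absurd (hgm (not_le.1 h).le) (not_le.2 (lt_of_le_of_lt hz hy₁))
      obtain ⟨y, hy, hyt⟩ := intermediate_value_Icc hzy hgc.continuousOn
        ⟨(not_le.1 hlt).le, hy₁.le⟩
      have : y ≤ z := le_csSup hbdd (show y ∈ g ⁻¹' Iic t from hyt.le)
      exact hlt (by rw [← le_antisymm this hy.1, hyt])
    rw [hSz, ← hzt, hg, ENNReal.ofReal_toReal (hfin _)]

theorem lintegral_Ioc_rpow {s : ℝ} (hs : -1 < s) {T : ℝ} (hT : 0 ≤ T) :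
    ∫⁻ t in Ioc 0 T, ENNReal.ofReal t ^ s =
      ENNReal.ofReal (s + 1)⁻¹ * ENNReal.ofReal T ^ (s + 1) := by
  have h1 : ∫⁻ t in Ioc 0 T, ENNReal.ofReal t ^ s = ∫⁻ t in Ioc 0 T, ENNReal.ofReal (t ^ s) :=
    setLIntegral_congr_fun measurableSet_Ioc fun t ht => ENNReal.ofReal_rpow_of_pos ht.1
  rw [h1, ← ofReal_integral_eq_lintegral_ofReal]
  · rw [← intervalIntegral.integral_of_le hT, integral_rpow (Or.inl hs), Real.zero_rpow (by linarith),
      ENNReal.ofReal_rpow_of_nonneg hT (by linarith), ← ENNReal.ofReal_mul (by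
        rw [inv_nonneg]; linarith)]
    congr 1; rw [sub_zero, div_eq_inv_mul]
  · exact (intervalIntegrable_iff_integrableOn_Ioc_of_le hT).1
      (intervalIntegral.intervalIntegrable_rpow' hs)
  · filter_upwards [ae_restrict_mem measurableSet_Ioc] with t ht
    exact Real.rpow_nonneg ht.1.le _

/-- Integrating a power of the distribution function of an atomless measure. -/
theorem lintegral_Iic_rpow_measure_Iic (ν : Measure ℝ) [NullSingletonClass ν] {s : ℝ} (hs : -1 < s) {x : ℝ}
    (hx : ν (Iic x) ≠ ∞) :
    ∫⁻ y in Iic x, ν (Iic y) ^ s ∂ν = ENNReal.ofReal (s + 1)⁻¹ * ν (Iic x) ^ (s + 1) := by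
  have : IsFiniteMeasure (ν.restrict (Iic x)) := ⟨by simpa using hx.lt_top⟩
  have h := map_toReal_measure_Iic (ν.restrict (Iic x))
  have hmeas : Measurable fun y => ((ν.restrict (Iic x)) (Iic y)).toReal :=
    (Monotone.measurable fun a b hab => measure_mono (Iic_subset_Iic.2 hab)).ennreal_toReal
  have h1 : ∫⁻ y in Iic x, ν (Iic y) ^ s ∂ν =
      ∫⁻ y in Iic x, ENNReal.ofReal ((ν.restrict (Iic x)) (Iic y)).toReal ^ s ∂ν := by
    refine setLIntegral_congr_fun measurableSet_Iic fun y hy => ?_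
    rw [ENNReal.ofReal_toReal (measure_ne_top _ _), Measure.restrict_apply measurableSet_Iic,
      inter_eq_left.2 (Iic_subset_Iic.2 hy)]
  rw [h1, ← lintegral_map (μ := ν.restrict (Iic x)) (f := fun t => ENNReal.ofReal t ^ s)
    (ENNReal.measurable_ofReal.pow_const s) hmeas, h, lintegral_Ioc_rpow hs toReal_nonneg]
  simp [ENNReal.ofReal_toReal hx]

theorem lintegral_Ici_rpow_measure_Ici (ν : Measure ℝ) [NullSingletonClass ν] {s : ℝ} (hs : -1 < s) {x : ℝ}
    (hx : ν (Ici x) ≠ ∞) :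
    ∫⁻ y in Ici x, ν (Ici y) ^ s ∂ν = ENNReal.ofReal (s + 1)⁻¹ * ν (Ici x) ^ (s + 1) := by
  have hm : ∀ y, (ν.map Neg.neg) (Iic y) = ν (Ici (-y)) := fun y => by
    rw [Measure.map_apply measurable_neg measurableSet_Iic]; simp
  have : NullSingletonClass (ν.map Neg.neg) := ⟨fun y => by
    rw [Measure.map_apply measurable_neg (measurableSet_singleton y)]
    simp⟩
  have h := lintegral_Iic_rpow_measure_Iic (ν.map Neg.neg) hs (x := -x) (by simpa [hm] using hx)
  rw [hm, neg_neg] at h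
  rw [← h, (MeasurableEquiv.neg ℝ).measurableEmbedding.restrict_map |> fun e =>
    show (ν.map Neg.neg).restrict (Iic (-x)) = (ν.restrict (Neg.neg ⁻¹' Iic (-x))).map Neg.neg
      from e _ _]
  rw [lintegral_map (by
    refine Measurable.pow_const (Monotone.measurable fun a b hab => measure_mono
      (Iic_subset_Iic.2 hab)) _) measurable_neg]
  simp [hm]

theorem measurable_measure_Iic (ν : Measure ℝ) : Measurable fun y => ν (Iic y) :=
  Monotone.measurable fun _ _ hab => measure_mono (Iic_subset_Iic.2 hab)

theorem measurable_measure_Ici (ν : Measure ℝ) : Measurable fun y => ν (Ici y) :=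
  Antitone.measurable fun _ _ hab => measure_mono (Ici_subset_Ici.2 hab)

theorem measurable_setLIntegral_Iic (ν : Measure ℝ) (f : ℝ → ℝ≥0∞) :
    Measurable fun y => ∫⁻ t in Iic y, f t ∂ν :=
  Monotone.measurable fun _ _ hab => lintegral_mono_set (Iic_subset_Iic.2 hab)

theorem measurable_setLIntegral_Ici (ν : Measure ℝ) (f : ℝ → ℝ≥0∞) :
    Measurable fun y => ∫⁻ t in Ici y, f t ∂ν :=
  Antitone.measurable fun _ _ hab => lintegral_mono_set (Ici_subset_Ici.2 hab)

/-- Tonelli's theorem on the region `y ≤ x`. -/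
theorem lintegral_mul_setLIntegral_Iic (ν μ : Measure ℝ) [SFinite ν] [SFinite μ]
    {g k : ℝ → ℝ≥0∞} (hg : Measurable g) (hk : Measurable k) :
    ∫⁻ x, g x * ∫⁻ y in Iic x, k y ∂ν ∂μ = ∫⁻ y, k y * ∫⁻ x in Ici y, g x ∂μ ∂ν := by
  have hm : MeasurableSet {z : ℝ × ℝ | z.2 ≤ z.1} := measurableSet_le measurable_snd measurable_fst
  have h1 : ∀ x, g x * ∫⁻ y in Iic x, k y ∂ν =
      ∫⁻ y, {z : ℝ × ℝ | z.2 ≤ z.1}.indicator (fun z => g z.1 * k z.2) (x, y) ∂ν := fun x => by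
    rw [← lintegral_const_mul _ hk, ← lintegral_indicator measurableSet_Iic]
    rfl
  have h2 : ∀ y, k y * ∫⁻ x in Ici y, g x ∂μ =
      ∫⁻ x, {z : ℝ × ℝ | z.2 ≤ z.1}.indicator (fun z => g z.1 * k z.2) (x, y) ∂μ := fun y => by
    rw [← lintegral_const_mul _ hg, ← lintegral_indicator measurableSet_Ici]
    refine lintegral_congr fun x => ?_
    simp only [indicator, mem_Ici, mem_ofPred_eq, mul_comm]
  simp only [h1, h2]
  refine lintegral_lintegral_swap ?_
  exact (((hg.comp measurable_fst).mul (hk.comp measurable_snd)).indicator hm).aemeasurable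

theorem ae_measure_Ici_ne_zero (ν : Measure ℝ) : ∀ᵐ x ∂ν, ν (Ici x) ≠ 0 := by
  rw [ae_iff]
  refine measure_null_of_locally_null _ fun x hx => ?_
  simp only [not_not, mem_ofPred_eq] at hx
  by_cases h : ∃ y < x, ν (Ici y) = 0
  · obtain ⟨y, hy, h0⟩ := h
    exact ⟨Ici y, mem_nhdsWithin_of_mem_nhds (Ici_mem_nhds hy), h0⟩
  · refine ⟨_, self_mem_nhdsWithin, measure_mono_null (fun y hy => ?_) hx⟩
    by_contra hlt
    exact h ⟨y, not_le.1 hlt, by simpa using hy⟩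

theorem ae_measure_Iic_ne_zero (ν : Measure ℝ) : ∀ᵐ x ∂ν, ν (Iic x) ≠ 0 := by
  rw [ae_iff]
  refine measure_null_of_locally_null _ fun x hx => ?_
  simp only [not_not, mem_ofPred_eq] at hx
  by_cases h : ∃ y > x, ν (Iic y) = 0
  · obtain ⟨y, hy, h0⟩ := h
    exact ⟨Iic y, mem_nhdsWithin_of_mem_nhds (Iic_mem_nhds hy), h0⟩
  · refine ⟨_, self_mem_nhdsWithin, measure_mono_null (fun y hy => ?_) hx⟩
    by_contra hlt
    exact h ⟨y, not_le.1 hlt, by simpa using hy⟩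

/-- `V ^ b` recovered from the integral of `V ^ (b - 1)`, for `V` the distribution function. -/
theorem rpow_measure_Iic (ν : Measure ℝ) [NullSingletonClass ν] {b : ℝ} (hb : 0 < b) {x : ℝ}
    (hx : ν (Iic x) ≠ ∞) :
    ν (Iic x) ^ b = ENNReal.ofReal b * ∫⁻ y in Iic x, ν (Iic y) ^ (b - 1) ∂ν := by
  rw [lintegral_Iic_rpow_measure_Iic ν (by linarith) hx, sub_add_cancel, ← mul_assoc,
    ← ENNReal.ofReal_mul hb.le, mul_inv_cancel₀ hb.ne', ofReal_one, one_mul]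

theorem rpow_measure_Ici (ν : Measure ℝ) [NullSingletonClass ν] {b : ℝ} (hb : 0 < b) {x : ℝ}
    (hx : ν (Ici x) ≠ ∞) :
    ν (Ici x) ^ b = ENNReal.ofReal b * ∫⁻ y in Ici x, ν (Ici y) ^ (b - 1) ∂ν := by
  rw [lintegral_Ici_rpow_measure_Ici ν (by linarith) hx, sub_add_cancel, ← mul_assoc,
    ← ENNReal.ofReal_mul hb.le, mul_inv_cancel₀ hb.ne', ofReal_one, one_mul]

theorem lintegral_mul_rpow_le_of_antitone (ν : Measure ℝ) [NullSingletonClass ν] {s : ℝ} (hs : -1 < s)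
    {θ : ℝ → ℝ≥0∞} (hθ : Antitone θ) {x : ℝ} (hx : ν (Iic x) ≠ ∞) :
    θ x * (ENNReal.ofReal (s + 1)⁻¹ * ν (Iic x) ^ (s + 1)) ≤
      ∫⁻ y in Iic x, θ y * ν (Iic y) ^ s ∂ν := by
  rw [← lintegral_Iic_rpow_measure_Iic ν hs hx,
    ← lintegral_const_mul _ ((measurable_measure_Iic ν).pow_const s)]
  exact setLIntegral_mono' measurableSet_Iic fun y hy => mul_le_mul_left (hθ hy) _

/-- The exponential function with values in `ℝ≥0∞`. -/
def eexp (t : ℝ) : ℝ≥0∞ := ENNReal.ofReal (Real.exp t)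

theorem exists_eexp {x : ℝ≥0∞} (h0 : x ≠ 0) (hx : x ≠ ∞) : ∃ t, x = eexp t :=
  ⟨Real.log x.toReal, by
    rw [eexp, Real.exp_log (ENNReal.toReal_pos h0 hx), ENNReal.ofReal_toReal hx]⟩

theorem eexp_rpow (t s : ℝ) : eexp t ^ s = eexp (t * s) := by
  rw [eexp, eexp, ENNReal.ofReal_rpow_of_pos (Real.exp_pos _), Real.exp_mul]

theorem eexp_mul (s t : ℝ) : eexp s * eexp t = eexp (s + t) := by
  rw [eexp, eexp, eexp, ← ENNReal.ofReal_mul (Real.exp_pos _).le, Real.exp_add]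

theorem eexp_le {s t : ℝ} : eexp s ≤ eexp t ↔ s ≤ t := by
  rw [eexp, eexp, ENNReal.ofReal_le_ofReal_iff (Real.exp_pos _).le, Real.exp_le_exp]

theorem eexp_ne_zero (t : ℝ) : eexp t ≠ 0 := by
  rw [eexp, Ne, ENNReal.ofReal_eq_zero, not_le]; exact Real.exp_pos _

theorem eexp_zero : eexp 0 = 1 := by simp [eexp]

theorem lintegral_Iic_rpow_le {p : ℝ} (hp : 1 < p) (ν : Measure ℝ) [NullSingletonClass ν]
    {f : ℝ → ℝ≥0∞} (hf : Measurable f) {x : ℝ} (hV : ∀ x, ν (Iic x) ≠ ∞) :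
    (∫⁻ y in Iic x, f y ∂ν) ^ p ≤ 2 ^ (p - 1) * (ν (Iic x) ^ ((p - 1) / 2) *
      ∫⁻ y in Iic x, f y ^ p * ν (Iic y) ^ ((p - 1) / 2) ∂ν) := by
  have hp0 : 0 < p := by linarith
  have hm := measurable_measure_Iic ν
  have h1 : ∫⁻ y in Iic x, f y ∂ν = ∫⁻ y in Iic x,
      (f y ^ p * ν (Iic y) ^ ((p - 1) / 2)) ^ (1 / p) *
        (ν (Iic y) ^ (-(1 / 2) : ℝ)) ^ ((p - 1) / p) ∂ν := by
    refine lintegral_congr_ae (ae_restrict_of_ae ?_)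
    filter_upwards [ae_measure_Iic_ne_zero ν] with y hy
    rw [ENNReal.mul_rpow_of_nonneg _ _ (by positivity), ← ENNReal.rpow_mul, mul_one_div_cancel hp0.ne',
      ENNReal.rpow_one, mul_assoc]
    obtain ⟨t, ht⟩ := exists_eexp hy (hV y)
    rw [ht]
    simp only [eexp_rpow, eexp_mul]
    rw [show t * ((p - 1) / 2) * (1 / p) + t * -(1 / 2) * ((p - 1) / p) = 0 by field_simp; ring,
      eexp_zero, mul_one]
  have h2 := ENNReal.lintegral_mul_norm_pow_le (μ := ν.restrict (Iic x))
    (((hf.pow_const p).mul (hm.pow_const ((p - 1) / 2))).aemeasurable)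
    ((hm.pow_const (-(1 / 2) : ℝ)).aemeasurable) (p := 1 / p) (q := (p - 1) / p)
    (by positivity) (div_nonneg (by linarith) hp0.le) (by field_simp; ring)
  simp only [Pi.mul_apply] at h2
  rw [← h1, lintegral_Iic_rpow_measure_Iic ν (by norm_num) (hV x)] at h2
  refine (ENNReal.rpow_le_rpow h2 hp0.le).trans_eq ?_
  rw [ENNReal.mul_rpow_of_nonneg _ _ hp0.le, ← ENNReal.rpow_mul, one_div_mul_cancel hp0.ne',
    ENNReal.rpow_one, ← ENNReal.rpow_mul, div_mul_cancel₀ _ hp0.ne',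
    ENNReal.mul_rpow_of_nonneg _ _ (by linarith), ← ENNReal.rpow_mul]
  have e1 : ENNReal.ofReal (-(1 / 2) + 1)⁻¹ = 2 := by norm_num
  rw [e1, mul_comm, mul_assoc]
  congr 3
  ring

section
variable {p q : ℝ} (hp : 1 < p) (hq : 0 < q) (hqp : q < p)
include hp hq hqp

theorem hardy_weight_le {V₁ V₂ P₁ P₂ M : ℝ≥0∞} (hV₁ : V₁ ≠ 0) (hV₁' : V₁ ≠ ∞) (hV₂ : V₂ ≠ 0)
    (hV₂' : V₂ ≠ ∞) (hP₁ : P₁ ≠ 0) (hP₁' : P₁ ≠ ∞) (hP₂ : P₂ ≠ 0) (hP₂' : P₂ ≠ ∞)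
    (h₁ : V₁ ^ ((p - 1) * q / (p - q)) * P₁ ^ (q / (2 * (p - q))) ≤
      ENNReal.ofReal ((p - 1) * q / (p - q)) * M)
    (h₂ : V₂ ^ ((p - 1) * q / (p - q)) * P₂ ^ (q / (2 * (p - q))) ≤
      ENNReal.ofReal ((p - 1) * q / (p - q)) * M) :
    V₁ ^ ((p - 1) / 2) * (P₁ ^ (q / (2 * (p - q))) * M) ^ (-((p - q) / q)) ≤
      ENNReal.ofReal ((p - 1) * q / (p - q)) ^ ((p - q) / q) *
        (P₁ ^ (-(3 / 4) : ℝ) * (V₂ ^ (-((p - 1) / 2)) * P₂ ^ (-(1 / 4) : ℝ))) := by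
  have hpq : 0 < p - q := by linarith
  have hp1 : 0 < p - 1 := by linarith
  have hb : 0 < (p - 1) * q / (p - q) := by positivity
  obtain ⟨v₁, rfl⟩ := exists_eexp hV₁ hV₁'
  obtain ⟨v₂, rfl⟩ := exists_eexp hV₂ hV₂'
  obtain ⟨s₁, rfl⟩ := exists_eexp hP₁ hP₁'
  obtain ⟨s₂, rfl⟩ := exists_eexp hP₂ hP₂'
  obtain ⟨β, hβ⟩ := exists_eexp (x := ENNReal.ofReal ((p - 1) * q / (p - q)))
    (by simpa using hb) ENNReal.ofReal_ne_top
  rw [hβ] at h₁ h₂ ⊢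
  rcases eq_or_ne M ∞ with rfl | hM
  · simp only [eexp_rpow]
    rw [ENNReal.mul_top (eexp_ne_zero _), ENNReal.top_rpow_of_neg (by
      rw [neg_lt_zero]; positivity)]
    simp
  have hM0 : M ≠ 0 := by
    rintro rfl
    simp only [eexp_rpow, eexp_mul, mul_zero, nonpos_iff_eq_zero] at h₁
    exact eexp_ne_zero _ h₁
  obtain ⟨m, rfl⟩ := exists_eexp hM0 hM
  simp only [eexp_rpow, eexp_mul, eexp_le] at h₁ h₂ ⊢
  have h3 : (β + m) * ((p - q) / q) ≥ (v₁ * ((p - 1) * q / (p - q)) + s₁ * (q / (2 * (p - q))) +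
      (v₂ * ((p - 1) * q / (p - q)) + s₂ * (q / (2 * (p - q))))) / 2 * ((p - q) / q) :=
    mul_le_mul_of_nonneg_right (by linarith) (by positivity)
  have h4 : (v₁ * ((p - 1) * q / (p - q)) + s₁ * (q / (2 * (p - q))) +
      (v₂ * ((p - 1) * q / (p - q)) + s₂ * (q / (2 * (p - q))))) / 2 * ((p - q) / q) =
      v₁ * ((p - 1) / 2) + s₁ / 4 + v₂ * ((p - 1) / 2) + s₂ / 4 := by
    field_simp; ring
  have h5 : (s₁ * (q / (2 * (p - q))) + m) * -((p - q) / q) =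
      - s₁ / 2 - (β + m) * ((p - q) / q) + β * ((p - q) / q) := by
    field_simp; ring
  rw [h5]
  rw [h4] at h3
  linarith

/-- Hardy's inequality below the diagonal (`q < p`), with respect to atomless measures. -/
theorem exists_hardy_le : ∃ C : ℝ≥0∞, C ≠ ∞ ∧ ∀ (ν μ : Measure ℝ) [SFinite ν] [SFinite μ]
    [NullSingletonClass ν] [NullSingletonClass μ] (f : ℝ → ℝ≥0∞), Measurable f →
    (∀ x, ν (Iic x) ≠ ∞) → (∀ x, ν (Iic x) ≠ 0 → μ (Ici x) ≠ ∞) →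
    ∫⁻ x, (∫⁻ y in Iic x, f y ∂ν) ^ q ∂μ ≤
      C * ((∫⁻ x, μ (Ici x) ^ (q / (p - q)) * ν (Iic x) ^ ((p - 1) * q / (p - q)) ∂μ) ^
        ((p - q) / p) * (∫⁻ y, f y ^ p ∂ν) ^ (q / p)) := by
  have hpq : 0 < p - q := by linarith
  have hp1 : 0 < p - 1 := by linarith
  have hp0 : 0 < p := by linarith
  set b := (p - 1) * q / (p - q) with hb_def
  set c := q / (2 * (p - q)) with hc_def
  set a := (p - q) / q with ha_def
  have hb : 0 < b := by positivity
  have hc : 0 < c := by positivity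
  have ha : 0 < a := by positivity
  set β := ENNReal.ofReal b with hβ_def
  have hβ0 : β ≠ 0 := by simpa [β] using hb
  have hβt : β ≠ ∞ := ENNReal.ofReal_ne_top
  set D : ℝ≥0∞ := 2 ^ (p - 1) * (β ^ a * 4) with hD_def
  set A : ℝ≥0∞ := ENNReal.ofReal (2 * c + 1) * β⁻¹ with hA_def
  refine ⟨D ^ (q / p) * A ^ ((p - q) / p), ?_, ?_⟩
  · refine ENNReal.mul_ne_top (ENNReal.rpow_ne_top_of_nonneg (by positivity) ?_)
      (ENNReal.rpow_ne_top_of_nonneg (by positivity) ?_)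
    · exact ENNReal.mul_ne_top (ENNReal.rpow_ne_top_of_nonneg hp1.le (by simp))
        (ENNReal.mul_ne_top (ENNReal.rpow_ne_top_of_nonneg ha.le hβt) (by simp))
    · exact ENNReal.mul_ne_top ENNReal.ofReal_ne_top (ENNReal.inv_ne_top.2 hβ0)
  intro ν μ _ _ _ _ f hf hV hP
  have mV := measurable_measure_Iic ν
  have mP := measurable_measure_Ici μ
  set F := ∫⁻ x, μ (Ici x) ^ (q / (p - q)) * ν (Iic x) ^ b ∂μ with hF_def
  set M : ℝ → ℝ≥0∞ := fun x => ∫⁻ y in Iic x, μ (Ici y) ^ c * ν (Iic y) ^ (b - 1) ∂ν with hM_def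
  have mM : Measurable M := measurable_setLIntegral_Iic ν _
  set m : ℝ → ℝ≥0∞ := fun x => μ (Ici x) ^ c * M x with hm_def
  have mm : Measurable m := (mP.pow_const c).mul mM
  set H : ℝ → ℝ≥0∞ := fun x => ∫⁻ y in Iic x, f y ∂ν with hH_def
  have mH : Measurable H := measurable_setLIntegral_Iic ν f
  have hM : ∀ x y, y ≤ x → ν (Iic y) ^ b * μ (Ici y) ^ c ≤ β * M x := by
    intro x y hyx
    have h := lintegral_mul_rpow_le_of_antitone ν (s := b - 1) (by linarith)
      (θ := fun x => μ (Ici x) ^ c) (fun s t hst =>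
        ENNReal.rpow_le_rpow (measure_mono (Ici_subset_Ici.2 hst)) hc.le) (hV y)
    simp only [sub_add_cancel] at h
    have h' : M y ≤ M x := lintegral_mono_set (Iic_subset_Iic.2 hyx)
    refine le_trans (le_of_eq ?_) (mul_le_mul_right (h.trans h') β)
    rw [hβ_def, mul_left_comm, ← mul_assoc (ENNReal.ofReal b), ← ENNReal.ofReal_mul hb.le, mul_inv_cancel₀ hb.ne',
      ENNReal.ofReal_one, one_mul, mul_comm]
  -- the mass of `m`
  have hF2 : F = β * ∫⁻ y, ν (Iic y) ^ (b - 1) * ∫⁻ x in Ici y, μ (Ici x) ^ (2 * c) ∂μ ∂ν := by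
    rw [← lintegral_mul_setLIntegral_Iic ν μ (mP.pow_const _) (mV.pow_const _),
      ← lintegral_const_mul _ ((mP.pow_const _).fun_mul (measurable_setLIntegral_Iic ν _))]
    refine lintegral_congr fun x => ?_
    rw [rpow_measure_Iic ν hb (hV x), mul_left_comm]
    congr 3
    rw [hc_def]; field_simp
  have hmF : ∫⁻ x, m x ∂μ ≤ A * F := by
    simp only [hm_def, hM_def]
    rw [lintegral_mul_setLIntegral_Iic ν μ (mP.pow_const _)
      ((mP.pow_const _).fun_mul (mV.pow_const _)), hF2, hA_def, mul_assoc, ← mul_assoc β⁻¹,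
      ENNReal.inv_mul_cancel hβ0 hβt, one_mul, ← lintegral_const_mul _
        ((mV.pow_const _).fun_mul (measurable_setLIntegral_Ici μ _))]
    refine lintegral_mono_ae ?_
    filter_upwards [ae_measure_Iic_ne_zero ν] with y hy
    have h1 : μ (Ici y) ^ c * ∫⁻ x in Ici y, μ (Ici x) ^ c ∂μ ≤ μ (Ici y) ^ (2 * c + 1) := by
      have : ∫⁻ x in Ici y, μ (Ici x) ^ c ∂μ ≤ ∫⁻ x in Ici y, μ (Ici y) ^ c ∂μ :=
        setLIntegral_mono' measurableSet_Ici fun x hx =>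
          ENNReal.rpow_le_rpow (measure_mono (Ici_subset_Ici.2 hx)) hc.le
      refine (mul_le_mul_right this _).trans_eq ?_
      rw [setLIntegral_const, ← mul_assoc, ← ENNReal.rpow_add_of_nonneg _ _ hc.le hc.le,
        ENNReal.rpow_add_of_nonneg _ _ (by positivity) zero_le_one, ENNReal.rpow_one, two_mul]
    rw [rpow_measure_Ici μ (b := 2 * c + 1) (by positivity) (hP y hy), add_sub_cancel_right] at h1
    calc _ = ν (Iic y) ^ (b - 1) * (μ (Ici y) ^ c * ∫⁻ x in Ici y, μ (Ici x) ^ c ∂μ) := by ring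
      _ ≤ _ := mul_le_mul_right h1 _
      _ = _ := by ring
  -- the diagonal estimate
  have hdiag : ∫⁻ x, H x ^ p * m x ^ (-a) ∂μ ≤ D * ∫⁻ y, f y ^ p ∂ν := by
    have h1 : ∫⁻ x, H x ^ p * m x ^ (-a) ∂μ ≤ ∫⁻ x, 2 ^ (p - 1) *
        ((ν (Iic x) ^ ((p - 1) / 2) * m x ^ (-a)) *
          ∫⁻ y in Iic x, f y ^ p * ν (Iic y) ^ ((p - 1) / 2) ∂ν) ∂μ := by
      refine lintegral_mono fun x => ?_
      refine (mul_le_mul_left (lintegral_Iic_rpow_le hp ν hf hV) _).trans_eq ?_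
      ring
    refine h1.trans ?_
    rw [lintegral_const_mul _ (((mV.pow_const _).fun_mul (mm.pow_const _)).fun_mul
      (measurable_setLIntegral_Iic ν _)), lintegral_mul_setLIntegral_Iic ν μ
        ((mV.pow_const _).fun_mul (mm.pow_const _)) ((hf.pow_const _).fun_mul (mV.pow_const _)), hD_def,
        mul_assoc]
    refine mul_le_mul_right ?_ _
    rw [← lintegral_const_mul _ (hf.pow_const p)]
    refine lintegral_mono_ae ?_
    filter_upwards [ae_measure_Iic_ne_zero ν] with y hy
    have hPy := hP y hy
    rcases eq_or_ne (μ (Ici y)) 0 with hP0 | hP0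
    · rw [setLIntegral_measure_zero _ _ hP0, mul_zero]; exact zero_le
    have h2 : ∫⁻ x in Ici y, ν (Iic x) ^ ((p - 1) / 2) * m x ^ (-a) ∂μ ≤
        ∫⁻ x in Ici y, β ^ a * (ν (Iic y) ^ (-((p - 1) / 2)) * μ (Ici y) ^ (-(1 / 4) : ℝ)) *
          μ (Ici x) ^ (-(3 / 4) : ℝ) ∂μ := by
      refine setLIntegral_mono_ae' measurableSet_Ici ?_
      filter_upwards [ae_measure_Ici_ne_zero μ] with x hx hyx
      have hVx : ν (Iic y) ≤ ν (Iic x) := measure_mono (Iic_subset_Iic.2 hyx)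
      have hVx0 : ν (Iic x) ≠ 0 := fun h => hy (le_antisymm (h ▸ hVx) zero_le)
      refine (hardy_weight_le hp hq hqp hVx0 (hV x) hy (hV y) hx (hP x hVx0) hP0 hPy
        (hM x x le_rfl) (hM x y hyx)).trans_eq ?_
      ring
    rw [lintegral_const_mul _ (mP.pow_const _),
      lintegral_Ici_rpow_measure_Ici μ (by norm_num) hPy] at h2
    refine (mul_le_mul_right h2 _).trans_eq ?_
    have e1 : ENNReal.ofReal (-(3 / 4) + 1)⁻¹ = 4 := by norm_num
    rw [e1]
    obtain ⟨v, hv⟩ := exists_eexp hy (hV y)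
    obtain ⟨s, hs⟩ := exists_eexp hP0 hPy
    rw [hv, hs]
    simp only [eexp_rpow]
    calc _ = β ^ a * 4 * f y ^ p * ((eexp (v * ((p - 1) / 2)) * eexp (v * -((p - 1) / 2))) *
          (eexp (s * -(1 / 4)) * eexp (s * (-(3 / 4) + 1)))) := by ring
      _ = _ := by
        simp only [eexp_mul]
        rw [show v * ((p - 1) / 2) + v * -((p - 1) / 2) + (s * -(1 / 4) + s * (-(3 / 4) + 1)) = 0
          by ring, eexp_zero, mul_one]
  rcases eq_or_ne F ∞ with hFt | hFt
  · rcases eq_or_ne (∫⁻ y, f y ^ p ∂ν) 0 with h0 | h0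
    · have hf0 : f =ᵐ[ν] 0 := by
        rw [lintegral_eq_zero_iff (hf.pow_const p)] at h0
        filter_upwards [h0] with y hy
        exact (ENNReal.rpow_eq_zero_iff_of_pos hp0).1 hy
      have : ∀ x, ∫⁻ y in Iic x, f y ∂ν = 0 := fun x => by
        rw [lintegral_congr_ae (ae_restrict_of_ae hf0)]; simp
      simp [this, ENNReal.zero_rpow_of_pos hq]
    · have h1 : (∫⁻ y, f y ^ p ∂ν) ^ (q / p) ≠ 0 := fun h =>
        h0 ((ENNReal.rpow_eq_zero_iff_of_pos (by positivity)).1 h)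
      have hA0 : A ≠ 0 := mul_ne_zero (by
        rw [Ne, ENNReal.ofReal_eq_zero, not_le]; positivity) (ENNReal.inv_ne_zero.2 hβt)
      have hD0 : D ≠ 0 := mul_ne_zero (by simp [ENNReal.rpow_eq_zero_iff])
        (mul_ne_zero (by simp [ENNReal.rpow_eq_zero_iff, hβ0, hβt]) (by simp))
      rw [hFt, ENNReal.top_rpow_of_pos (by positivity), ENNReal.top_mul h1, ENNReal.mul_top]
      · exact le_top
      · refine mul_ne_zero (fun h => hD0 ((ENNReal.rpow_eq_zero_iff_of_pos (by positivity)).1 h))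
          (fun h => hA0 ((ENNReal.rpow_eq_zero_iff_of_pos (by positivity)).1 h))
  have hmt : ∀ᵐ x ∂μ, m x < ∞ := ae_lt_top mm (ne_top_of_le_ne_top (ENNReal.mul_ne_top
    (ENNReal.mul_ne_top ENNReal.ofReal_ne_top (ENNReal.inv_ne_top.2 hβ0)) hFt) hmF)
  have hpt : ∀ᵐ x ∂μ, H x ^ q ≤ (H x ^ p * m x ^ (-a)) ^ (q / p) * m x ^ ((p - q) / p) := by
    filter_upwards [hmt, ae_measure_Ici_ne_zero μ] with x hmx hPx
    rcases eq_or_ne (ν (Iic x)) 0 with hV0 | hV0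
    · have : H x = 0 := setLIntegral_measure_zero _ _ hV0
      rw [this, ENNReal.zero_rpow_of_pos hq]; exact zero_le
    have hm0 : m x ≠ 0 := by
      refine mul_ne_zero (by simp [ENNReal.rpow_eq_zero_iff, hPx, hc.not_gt, hP x hV0]) fun h => ?_
      have h' := hM x x le_rfl
      rw [h, mul_zero, nonpos_iff_eq_zero, mul_eq_zero] at h'
      rcases h' with h' | h'
      · exact hV0 ((ENNReal.rpow_eq_zero_iff_of_pos hb).1 h')
      · exact hPx ((ENNReal.rpow_eq_zero_iff_of_pos hc).1 h')
    obtain ⟨t, ht⟩ := exists_eexp hm0 hmx.ne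
    rw [ENNReal.mul_rpow_of_nonneg _ _ (by positivity), ← ENNReal.rpow_mul, ht, mul_assoc]
    simp only [eexp_rpow, eexp_mul]
    rw [show t * -a * (q / p) + t * ((p - q) / p) = 0 by rw [ha_def]; field_simp; ring, eexp_zero,
      mul_one, mul_div_cancel₀ _ hp0.ne']
  refine (lintegral_mono_ae hpt).trans ((ENNReal.lintegral_mul_norm_pow_le
    ((mH.pow_const _).fun_mul (mm.pow_const _)).aemeasurable mm.aemeasurable (by positivity)
    (by positivity) (by field_simp; ring)).trans ?_)
  refine (mul_le_mul' (ENNReal.rpow_le_rpow hdiag (by positivity))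
    (ENNReal.rpow_le_rpow hmF (by positivity))).trans_eq ?_
  rw [ENNReal.mul_rpow_of_nonneg D _ (by positivity), ENNReal.mul_rpow_of_nonneg A F (by positivity)]
  ring

end

section
variable {p q : ℝ} (hp : 1 < p) (hq : 0 < q) (hqp : q < p)
include hp hq hqp

/-- A test function that saturates Hardy's inequality below the diagonal. -/
theorem exists_le_hardy : ∃ C : ℝ≥0∞, C ≠ ∞ ∧ ∀ (ν μ : Measure ℝ) [SFinite ν] [SFinite μ]
    [NullSingletonClass ν] [NullSingletonClass μ],
    (∀ x, ν (Iic x) ≠ ∞) → (∀ x, μ (Ici x) ≠ ∞) → ∃ f : ℝ → ℝ≥0∞, Measurable f ∧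
      ∫⁻ y, f y ^ p ∂ν ≤
        C * ∫⁻ x, μ (Ici x) ^ (q / (p - q)) * ν (Iic x) ^ ((p - 1) * q / (p - q)) ∂μ ∧
      ∫⁻ x, μ (Ici x) ^ (q / (p - q)) * ν (Iic x) ^ ((p - 1) * q / (p - q)) ∂μ ≤
        C * ∫⁻ x, (∫⁻ y in Iic x, f y ∂ν) ^ q ∂μ := by
  have hpq : 0 < p - q := by linarith
  have hp1 : 0 < p - 1 := by linarith
  have hp0 : 0 < p := by linarith
  set b := (p - 1) * q / (p - q) with hb_def
  set a := q / (p - q) with ha_def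
  set s := (b - 1) / p with hs_def
  have hb : 0 < b := by positivity
  have ha : 0 < a := by positivity
  have hs : -1 < s := by
    rw [hs_def, lt_div_iff₀ hp0]; linarith
  have hs1 : 0 < s + 1 := by linarith
  have hsb : (s + 1) * q = b := by
    rw [hs_def, hb_def]; field_simp; ring
  set β := ENNReal.ofReal b with hβ_def
  have hβ0 : β ≠ 0 := by simpa [β] using hb
  have hβt : β ≠ ∞ := ENNReal.ofReal_ne_top
  set C₁ : ℝ≥0∞ := ENNReal.ofReal (a + 1) * β⁻¹ with hC₁
  set C₂ : ℝ≥0∞ := ENNReal.ofReal (s + 1) ^ q with hC₂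
  refine ⟨C₁ + C₂, ?_, ?_⟩
  · exact ENNReal.add_ne_top.2 ⟨ENNReal.mul_ne_top ENNReal.ofReal_ne_top (ENNReal.inv_ne_top.2 hβ0),
      ENNReal.rpow_ne_top_of_nonneg hq.le ENNReal.ofReal_ne_top⟩
  intro ν μ _ _ _ _ hV hP
  have mV := measurable_measure_Iic ν
  have mP := measurable_measure_Ici μ
  set f : ℝ → ℝ≥0∞ := fun y => μ (Ici y) ^ (1 / (p - q)) * ν (Iic y) ^ s with hf_def
  have mf : Measurable f := (mP.pow_const _).fun_mul (mV.pow_const _)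
  refine ⟨f, mf, ?_, ?_⟩
  · refine le_trans (le_of_eq ?_) (mul_le_mul_left (le_add_right le_rfl : C₁ ≤ C₁ + C₂) _)
    have h1 : ∀ y, f y ^ p = ENNReal.ofReal (a + 1) *
        (ν (Iic y) ^ (b - 1) * ∫⁻ x in Ici y, μ (Ici x) ^ a ∂μ) := fun y => by
      have h := rpow_measure_Ici μ (b := a + 1) (by positivity) (hP y)
      rw [add_sub_cancel_right] at h
      rw [hf_def, ENNReal.mul_rpow_of_nonneg _ _ hp0.le, ← ENNReal.rpow_mul, ← ENNReal.rpow_mul,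
        show 1 / (p - q) * p = a + 1 by rw [ha_def]; field_simp; ring, h,
        show s * p = b - 1 by rw [hs_def]; field_simp]
      ring
    have h2 : ∀ x, ν (Iic x) ^ b = β * ∫⁻ y in Iic x, ν (Iic y) ^ (b - 1) ∂ν := fun x =>
      rpow_measure_Iic ν hb (hV x)
    simp only [h1, h2]
    rw [lintegral_const_mul _ ((mV.pow_const _).fun_mul (measurable_setLIntegral_Ici μ _)),
      ← lintegral_mul_setLIntegral_Iic ν μ (mP.pow_const _) (mV.pow_const _), hC₁, mul_assoc]
    congr 1
    simp only [mul_left_comm _ β]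
    rw [lintegral_const_mul _ ((mP.pow_const _).fun_mul (measurable_setLIntegral_Iic ν _)),
      ← mul_assoc, ENNReal.inv_mul_cancel hβ0 hβt, one_mul]
  · refine le_trans ?_ (mul_le_mul_left (le_add_left le_rfl : C₂ ≤ C₁ + C₂) _)
    rw [← lintegral_const_mul _ ((measurable_setLIntegral_Iic ν f).pow_const q)]
    refine lintegral_mono fun x => ?_
    have h := lintegral_mul_rpow_le_of_antitone ν hs (θ := fun y => μ (Ici y) ^ (1 / (p - q)))
      (fun s t hst => ENNReal.rpow_le_rpow (measure_mono (Ici_subset_Ici.2 hst)) (by positivity))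
      (hV x)
    have h' := mul_le_mul_right (ENNReal.rpow_le_rpow h hq.le) C₂
    refine le_trans (le_of_eq ?_) h'
    have e : ENNReal.ofReal (s + 1) * ENNReal.ofReal (s + 1)⁻¹ = 1 := by
      rw [← ENNReal.ofReal_mul hs1.le, mul_inv_cancel₀ hs1.ne', ENNReal.ofReal_one]
    rw [ENNReal.mul_rpow_of_nonneg _ _ hq.le, ENNReal.mul_rpow_of_nonneg _ _ hq.le,
      ← ENNReal.rpow_mul, ← ENNReal.rpow_mul, hsb, show 1 / (p - q) * q = a by rw [ha_def]; ring,
      mul_left_comm, ← mul_assoc C₂, hC₂, ← ENNReal.mul_rpow_of_nonneg _ _ hq.le, e,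
      ENNReal.one_rpow, one_mul]

end

theorem ENNReal.le_rpow_of_le_mul_rpow {x A : ℝ≥0∞} {θ : ℝ} (hθ : θ < 1) (hx : x ≠ ∞)
    (h : x ≤ A * x ^ θ) : x ≤ A ^ (1 / (1 - θ)) := by
  rcases eq_or_ne x 0 with rfl | hx0
  · exact zero_le
  have h1 : x ^ (1 - θ) ≤ A := by
    rw [ENNReal.rpow_sub _ _ hx0 hx, ENNReal.rpow_one]
    exact ENNReal.div_le_of_le_mul h
  have h2 := ENNReal.rpow_le_rpow h1 (z := 1 / (1 - θ)) (by
    rw [one_div, inv_nonneg]; linarith)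
  rwa [← ENNReal.rpow_mul, mul_one_div_cancel (by linarith), ENNReal.rpow_one] at h2

theorem ENNReal.rpow_le_rpow_of_nonpos_exponent {x y : ℝ≥0∞} (h : x ≤ y) {s : ℝ} (hs : s ≤ 0) :
    y ^ s ≤ x ^ s := by
  rw [← neg_neg s, ENNReal.rpow_neg, ENNReal.rpow_neg x, ENNReal.inv_le_inv]
  exact ENNReal.rpow_le_rpow h (by linarith)

instance MeasureTheory.Measure.withDensity.instNullSingletonClass {α : Type*} [MeasurableSpace α]
    (μ : Measure α) [NullSingletonClass μ] (f : α → ℝ≥0∞) :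
    NullSingletonClass (μ.withDensity f) :=
  ⟨fun x => withDensity_absolutelyContinuous _ _ (measure_singleton x)⟩

/-- A monotone majorant of `W ^ (a + 1) * T ^ (κ - 1)` with controlled integral. -/
theorem exists_monotone_majorant {a κ : ℝ} (ha : 0 < a) (hκ : 0 < κ) :
    ∃ C : ℝ≥0∞, C ≠ ∞ ∧ ∀ (τ ω : Measure ℝ) [SFinite τ] [SFinite ω] [NullSingletonClass τ]
      [NullSingletonClass ω], (∀ x, τ (Ici x) ≠ ∞) → (∀ x, ω (Iic x) ≠ ∞) →
      ∃ J : ℝ → ℝ≥0∞, Monotone J ∧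
        ∫⁻ x, J x ∂τ ≤ C * ∫⁻ x, ω (Iic x) ^ a * τ (Ici x) ^ κ ∂ω ∧
        ∀ x, ω (Iic x) ^ (a + 1) * τ (Ici x) ^ (κ - 1) ≤ J x := by
  have ha1 : 0 < a + 1 := by linarith
  rcases lt_or_ge κ 1 with h1 | h1
  · refine ⟨ENNReal.ofReal (a + 1) * ENNReal.ofReal κ⁻¹,
      ENNReal.mul_ne_top ENNReal.ofReal_ne_top ENNReal.ofReal_ne_top, ?_⟩
    intro τ ω _ _ _ _ hT hW
    have mT := measurable_measure_Ici τ
    have mW := measurable_measure_Iic ω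
    refine ⟨fun x => ω (Iic x) ^ (a + 1) * τ (Ici x) ^ (κ - 1), fun x y hxy => ?_, ?_,
      fun _ => le_rfl⟩
    · exact mul_le_mul' (ENNReal.rpow_le_rpow (measure_mono (Iic_subset_Iic.2 hxy)) ha1.le)
        (ENNReal.rpow_le_rpow_of_nonpos_exponent (measure_mono (Ici_subset_Ici.2 hxy))
          (by linarith))
    · have h2 : ∀ x, ω (Iic x) ^ (a + 1) * τ (Ici x) ^ (κ - 1) = ENNReal.ofReal (a + 1) *
          (τ (Ici x) ^ (κ - 1) * ∫⁻ y in Iic x, ω (Iic y) ^ a ∂ω) := fun x => by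
        rw [rpow_measure_Iic ω ha1 (hW x), add_sub_cancel_right]; ring
      simp only [h2]
      rw [lintegral_const_mul _ ((mT.pow_const _).fun_mul (measurable_setLIntegral_Iic ω _)),
        lintegral_mul_setLIntegral_Iic ω τ (mT.pow_const _) (mW.pow_const _), mul_assoc,
        ← lintegral_const_mul _ ((mW.pow_const _).fun_mul (mT.pow_const _))]
      refine mul_le_mul_right (le_of_eq (lintegral_congr fun x => ?_)) _
      rw [lintegral_Ici_rpow_measure_Ici τ (by linarith) (hT x), sub_add_cancel]
      ring
  · refine ⟨ENNReal.ofReal (a + 1), ENNReal.ofReal_ne_top, ?_⟩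
    intro τ ω _ _ _ _ hT hW
    have mT := measurable_measure_Ici τ
    have mW := measurable_measure_Iic ω
    refine ⟨fun x => ENNReal.ofReal (a + 1) * ∫⁻ y in Iic x, ω (Iic y) ^ a * τ (Ici y) ^ (κ - 1) ∂ω,
      fun x y hxy => mul_le_mul_right (lintegral_mono_set (Iic_subset_Iic.2 hxy)) _, ?_, fun x => ?_⟩
    · rw [lintegral_const_mul _ (measurable_setLIntegral_Iic ω _)]
      have h2 := lintegral_mul_setLIntegral_Iic ω τ (measurable_const (a := (1 : ℝ≥0∞)))
        ((mW.pow_const a).fun_mul (mT.pow_const (κ - 1)))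
      simp only [one_mul, lintegral_const, Measure.restrict_apply_univ] at h2
      rw [h2]
      refine mul_le_mul_right (le_of_eq (lintegral_congr fun x => ?_)) _
      nth_rewrite 2 [← ENNReal.rpow_one (τ (Ici x))]
      rw [mul_assoc, ← ENNReal.rpow_add_of_nonneg _ _ (by linarith) zero_le_one, sub_add_cancel]
    · rw [rpow_measure_Iic ω ha1 (hW x), add_sub_cancel_right, mul_assoc,
        ← lintegral_mul_const _ (mW.pow_const _)]
      refine mul_le_mul_right (setLIntegral_mono' measurableSet_Iic fun y hy => ?_) _
      exact mul_le_mul_right (ENNReal.rpow_le_rpow (measure_mono (Ici_subset_Ici.2 hy))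
        (by linarith)) _

section
variable {p q r : ℝ} (hp : 1 < p) (hq : 0 < q) (hqp : q < p) (hr : 0 < r) (hrp : r < p)
include hp hq hqp hr hrp

/-- A test function that saturates the iterated Hardy inequality in the second regime. -/
theorem exists_le_iterated_hardy : ∃ C : ℝ≥0∞, C ≠ ∞ ∧ ∀ (ν μ ω : Measure ℝ) [SFinite ν] [SFinite μ]
    [SFinite ω] [NullSingletonClass ν] [NullSingletonClass μ] [NullSingletonClass ω],
    (∀ x, ν (Iic x) ≠ ∞) → (∀ x, μ (Ici x) ≠ ∞) → (∀ x, ω (Iic x) ≠ ∞) →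
    (∀ x, ∫⁻ t in Ici x, μ (Ici t) ^ (r / (p - r)) * ν (Iic t) ^ ((p - 1) * r / (p - r)) ∂μ ≠ ∞) →
    ∃ f : ℝ → ℝ≥0∞, Measurable f ∧
      ∫⁻ y, f y ^ p ∂ν ≤ C * ∫⁻ x, ω (Iic x) ^ (q / (p - q)) *
        (∫⁻ t in Ici x, μ (Ici t) ^ (r / (p - r)) * ν (Iic t) ^ ((p - 1) * r / (p - r)) ∂μ) ^
          (q * (p - r) / (r * (p - q))) ∂ω ∧
      ∫⁻ x, ω (Iic x) ^ (q / (p - q)) *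
        (∫⁻ t in Ici x, μ (Ici t) ^ (r / (p - r)) * ν (Iic t) ^ ((p - 1) * r / (p - r)) ∂μ) ^
          (q * (p - r) / (r * (p - q))) ∂ω ≤
        C * ∫⁻ x, (∫⁻ t in Ici x, (∫⁻ y in Iic t, f y ∂ν) ^ r ∂μ) ^ (q / r) ∂ω := by
  have hpq : 0 < p - q := by linarith
  have hpr : 0 < p - r := by linarith
  have hp1 : 0 < p - 1 := by linarith
  have hp0 : 0 < p := by linarith
  set b := (p - 1) * r / (p - r) with hb_def
  set a := q / (p - q) with ha_def
  set ρ := r / (p - r) with hρ_def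
  set κ := q * (p - r) / (r * (p - q)) with hκ_def
  set s := (b - 1) / p with hs_def
  have hb : 0 < b := by positivity
  have ha : 0 < a := by positivity
  have hρ : 0 < ρ := by positivity
  have hκ : 0 < κ := by positivity
  have hs : -1 < s := by
    rw [hs_def, lt_div_iff₀ hp0]; linarith
  have hs1 : 0 < s + 1 := by linarith
  have hsb : (s + 1) * r = b := by
    rw [hs_def, hb_def]; field_simp; ring
  set β := ENNReal.ofReal b with hβ_def
  have hβ0 : β ≠ 0 := by simpa [β] using hb
  have hβt : β ≠ ∞ := ENNReal.ofReal_ne_top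
  obtain ⟨C₀, hC₀, hJ⟩ := exists_monotone_majorant ha hκ
  set c : ℝ≥0∞ := ENNReal.ofReal (s + 1)⁻¹ ^ r * ENNReal.ofReal (ρ + 1)⁻¹ ^ (r / p) with hc_def
  have hc0 : c ≠ 0 := by
    have h1 : ENNReal.ofReal (s + 1)⁻¹ ≠ 0 := by simpa using hs1
    have h2 : ENNReal.ofReal (ρ + 1)⁻¹ ≠ 0 := by
      rw [Ne, ENNReal.ofReal_eq_zero, not_le]; positivity
    simp only [hc_def, ne_eq, mul_eq_zero, ENNReal.rpow_eq_zero_iff, h1, h2, false_and,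
      ENNReal.ofReal_ne_top, or_self, not_false_eq_true]
  have hct : c ≠ ∞ := ENNReal.mul_ne_top (ENNReal.rpow_ne_top_of_nonneg hr.le ENNReal.ofReal_ne_top)
    (ENNReal.rpow_ne_top_of_nonneg (by positivity) ENNReal.ofReal_ne_top)
  set d : ℝ≥0∞ := c ^ (q / r) with hd_def
  have hd0 : d ≠ 0 := by simp [hd_def, ENNReal.rpow_eq_zero_iff, hc0, hct]
  have hdt : d ≠ ∞ := ENNReal.rpow_ne_top_of_nonneg (by positivity) hct
  refine ⟨β⁻¹ * C₀ + d⁻¹, ?_, ?_⟩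
  · exact ENNReal.add_ne_top.2 ⟨ENNReal.mul_ne_top (ENNReal.inv_ne_top.2 hβ0) hC₀,
      ENNReal.inv_ne_top.2 hd0⟩
  intro ν μ ω _ _ _ _ _ _ hV hU hW hK
  have mV := measurable_measure_Iic ν
  have mU := measurable_measure_Ici μ
  have mW := measurable_measure_Iic ω
  set k : ℝ → ℝ≥0∞ := fun t => μ (Ici t) ^ ρ * ν (Iic t) ^ b with hk_def
  have mk : Measurable k := (mU.pow_const _).fun_mul (mV.pow_const _)
  have hT : ∀ x, ∫⁻ t in Ici x, k t ∂μ = μ.withDensity k (Ici x) := fun x =>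
    (withDensity_apply _ measurableSet_Ici).symm
  change ∀ x, ∫⁻ t in Ici x, k t ∂μ ≠ ∞ at hK
  change ∃ f : ℝ → ℝ≥0∞, Measurable f ∧
      ∫⁻ y, f y ^ p ∂ν ≤ (β⁻¹ * C₀ + d⁻¹) * ∫⁻ x, ω (Iic x) ^ a * (∫⁻ t in Ici x, k t ∂μ) ^ κ ∂ω ∧
      ∫⁻ x, ω (Iic x) ^ a * (∫⁻ t in Ici x, k t ∂μ) ^ κ ∂ω ≤
        (β⁻¹ * C₀ + d⁻¹) * ∫⁻ x, (∫⁻ t in Ici x, (∫⁻ y in Iic t, f y ∂ν) ^ r ∂μ) ^ (q / r) ∂ω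
  obtain ⟨J, hJm, hJX, hJW⟩ := hJ (μ.withDensity k) ω (fun x => hT x ▸ hK x) hW
  simp only [← hT] at hJX hJW
  have mJ : Measurable J := hJm.measurable
  set Θ : ℝ → ℝ≥0∞ := fun y => ∫⁻ t in Ici y, J t * μ (Ici t) ^ ρ ∂μ with hΘ_def
  have aΘ : Antitone Θ := fun x y hxy => lintegral_mono_set (Ici_subset_Ici.2 hxy)
  have mΘ : Measurable Θ := aΘ.measurable
  have hΘ : ∀ t, J t * (ENNReal.ofReal (ρ + 1)⁻¹ * μ (Ici t) ^ (ρ + 1)) ≤ Θ t := fun t => by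
    rw [← lintegral_Ici_rpow_measure_Ici μ (by linarith) (hU t),
      ← lintegral_const_mul _ (mU.pow_const _)]
    exact setLIntegral_mono' measurableSet_Ici fun x hx => mul_le_mul_left (hJm hx) _
  set f : ℝ → ℝ≥0∞ := fun y => Θ y ^ (1 / p) * ν (Iic y) ^ s with hf_def
  have mf : Measurable f := (mΘ.pow_const _).fun_mul (mV.pow_const _)
  refine ⟨f, mf, ?_, ?_⟩
  · refine le_trans ?_ (mul_le_mul_left (le_add_right le_rfl : β⁻¹ * C₀ ≤ β⁻¹ * C₀ + d⁻¹) _)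
    rw [mul_assoc]
    refine le_trans ?_ (mul_le_mul_right hJX _)
    have h1 : ∀ y, f y ^ p = ν (Iic y) ^ (b - 1) * ∫⁻ t in Ici y, J t * μ (Ici t) ^ ρ ∂μ :=
      fun y => by
        rw [hf_def, ENNReal.mul_rpow_of_nonneg _ _ hp0.le, ← ENNReal.rpow_mul, ← ENNReal.rpow_mul,
          one_div_mul_cancel hp0.ne', ENNReal.rpow_one,
          show s * p = b - 1 by rw [hs_def]; field_simp, mul_comm]
    simp only [h1]
    rw [← lintegral_mul_setLIntegral_Iic ν μ (mJ.fun_mul (mU.pow_const _)) (mV.pow_const _),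
      lintegral_withDensity_eq_lintegral_mul _ mk mJ,
      ← lintegral_const_mul _ (mk.mul mJ)]
    refine lintegral_mono fun x => ?_
    simp only [Pi.mul_apply, hk_def]
    rw [rpow_measure_Iic ν hb (hV x)]
    calc _ = (β⁻¹ * β) * (J x * μ (Ici x) ^ ρ * ∫⁻ y in Iic x, ν (Iic y) ^ (b - 1) ∂ν) := by
          rw [ENNReal.inv_mul_cancel hβ0 hβt, one_mul]
      _ ≤ _ := le_of_eq (by ring)
  · refine le_trans ?_ (mul_le_mul_left (le_add_left le_rfl : d⁻¹ ≤ β⁻¹ * C₀ + d⁻¹) _)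
    rw [← lintegral_const_mul _ ((measurable_setLIntegral_Ici μ _).pow_const _)]
    refine lintegral_mono fun x => ?_
    set H : ℝ → ℝ≥0∞ := fun t => ∫⁻ y in Iic t, f y ∂ν with hH_def
    set T := ∫⁻ t in Ici x, k t ∂μ with hT_def
    have hH : ∀ t, c * (J t ^ (r / p) * k t) ≤ H t ^ r := fun t => by
      have h := lintegral_mul_rpow_le_of_antitone ν hs (θ := fun y => Θ y ^ (1 / p))
        (fun s t hst => ENNReal.rpow_le_rpow (aΘ hst) (by positivity)) (hV t)
      refine le_trans (le_of_eq ?_) (ENNReal.rpow_le_rpow ((mul_le_mul_left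
        (ENNReal.rpow_le_rpow (hΘ t) (by positivity)) _).trans h) hr.le)
      simp only [hc_def, hk_def]
      rw [ENNReal.mul_rpow_of_nonneg _ _ hr.le, ← ENNReal.rpow_mul,
        ENNReal.mul_rpow_of_nonneg _ _ hr.le, ← ENNReal.rpow_mul _ (s + 1), hsb,
        ENNReal.mul_rpow_of_nonneg _ _ (by positivity),
        ENNReal.mul_rpow_of_nonneg _ _ (by positivity), ← ENNReal.rpow_mul _ (ρ + 1),
        show (ρ + 1) * (1 / p * r) = ρ by rw [hρ_def]; field_simp; ring,
        show 1 / p * r = r / p by ring]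
      ring
    have hG : c * (J x ^ (r / p) * T) ≤ ∫⁻ t in Ici x, H t ^ r ∂μ := by
      rw [hT_def, ← mul_assoc, ← lintegral_const_mul _ mk]
      refine setLIntegral_mono' measurableSet_Ici fun t ht => le_trans ?_ (hH t)
      rw [mul_assoc]
      exact mul_le_mul_right (mul_le_mul_left (ENNReal.rpow_le_rpow (hJm ht) (by positivity)) _) _
    rcases eq_or_ne T 0 with h0 | h0
    · rw [h0, ENNReal.zero_rpow_of_pos hκ, mul_zero]; exact zero_le
    have h2 := ENNReal.rpow_le_rpow hG (z := q / r) (by positivity)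
    rw [ENNReal.mul_rpow_of_nonneg c _ (by positivity), ← hd_def,
      ENNReal.mul_rpow_of_nonneg _ T (by positivity), ← ENNReal.rpow_mul,
      show r / p * (q / r) = q / p by field_simp] at h2
    have h3 : ω (Iic x) ^ a * T ^ κ ≤ J x ^ (q / p) * T ^ (q / r) := by
      refine le_trans (le_of_eq ?_) (mul_le_mul_left (ENNReal.rpow_le_rpow (hJW x)
        (by positivity : 0 ≤ q / p)) _)
      rw [ENNReal.mul_rpow_of_nonneg _ _ (by positivity), ← ENNReal.rpow_mul, ← ENNReal.rpow_mul,
        mul_assoc, ← ENNReal.rpow_add _ _ h0 (hK x),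
        show (a + 1) * (q / p) = a by rw [ha_def]; field_simp; ring,
        show (κ - 1) * (q / p) + q / r = κ by rw [hκ_def]; field_simp; ring]
    refine h3.trans ?_
    rw [mul_comm d⁻¹, ← div_eq_mul_inv, ENNReal.le_div_iff_mul_le (Or.inl hd0) (Or.inl hdt), mul_comm]
    exact h2

end

/-- Integrated form of the estimate of `∫_{x}^{∞} W ^ c dτ` through the tails of `τ`. -/
theorem lintegral_rpow_mul_tail_le {c κ : ℝ} (hc : 0 < c) (hκ : 0 < κ) (τ ω : Measure ℝ)
    [SFinite ω] [NullSingletonClass τ] [NullSingletonClass ω]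
    (hW : ∀ x, ω (Iic x) ≠ ∞) (hT : ∀ x, ω (Iic x) ≠ 0 → τ (Ici x) ≠ ∞) :
    ∫⁻ x, (ω (Iic x) ^ c * ∫⁻ y in Ici x, ω (Iic y) ^ c ∂τ) ^ κ ∂ω ≤
      2 ^ κ * ENNReal.ofReal (1 + 2 * c * κ) * ∫⁻ x, ω (Iic x) ^ (2 * c * κ) * τ (Ici x) ^ κ ∂ω := by
  have mT := measurable_measure_Ici τ
  have mW := measurable_measure_Iic ω
  set a := 2 * c * κ with ha_def
  have ha : 0 < a := by positivity
  set R : ℝ → ℝ≥0∞ := fun x => ω (Iic x) ^ a * τ (Ici x) ^ κ +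
    ENNReal.ofReal a * ∫⁻ y in Ici x, τ (Ici y) ^ κ * ω (Iic y) ^ (a - 1) ∂ω with hR_def
  have hR : ∀ x y, x ≤ y → ω (Iic y) ^ a * τ (Ici y) ^ κ ≤ R x := by
    intro x y hxy
    have h1 : ∫⁻ z in Iic y, ω (Iic z) ^ (a - 1) ∂ω ≤
        ∫⁻ z in Iic x, ω (Iic z) ^ (a - 1) ∂ω + ∫⁻ z in Icc x y, ω (Iic z) ^ (a - 1) ∂ω := by
      refine le_trans (lintegral_mono_set fun z hz => ?_) (lintegral_union_le _ _ _)
      rcases le_total z x with h | h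
      · exact Or.inl h
      · exact Or.inr ⟨h, hz⟩
    rw [rpow_measure_Iic ω ha (hW y), hR_def]
    simp only
    rw [rpow_measure_Iic ω ha (hW x)]
    refine (mul_le_mul_left (mul_le_mul_right h1 _) _).trans ?_
    rw [mul_add, add_mul]
    refine add_le_add (mul_le_mul_right (ENNReal.rpow_le_rpow
      (measure_mono (Ici_subset_Ici.2 hxy)) hκ.le) _) ?_
    rw [mul_assoc, mul_comm _ (τ (Ici y) ^ κ), ← lintegral_const_mul _ (mW.pow_const _)]
    refine mul_le_mul_right (le_trans (setLIntegral_mono' measurableSet_Icc fun z hz =>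
      mul_le_mul_left (ENNReal.rpow_le_rpow (measure_mono (Ici_subset_Ici.2 hz.2)) hκ.le) _)
      (lintegral_mono_set Icc_subset_Ici_self)) _
  have hRc : ∀ x y, x ≤ y → ω (Iic y) ^ c * τ (Ici y) ^ (1 / 2 : ℝ) ≤ R x ^ (1 / (2 * κ)) := by
    intro x y hxy
    refine le_trans (le_of_eq ?_) (ENNReal.rpow_le_rpow (hR x y hxy) (by positivity))
    rw [ENNReal.mul_rpow_of_nonneg _ _ (by positivity), ← ENNReal.rpow_mul, ← ENNReal.rpow_mul,
      show a * (1 / (2 * κ)) = c by rw [ha_def]; field_simp,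
      show κ * (1 / (2 * κ)) = 1 / 2 by field_simp]
  have hpt : ∀ x, (ω (Iic x) ^ c * ∫⁻ y in Ici x, ω (Iic y) ^ c ∂τ) ^ κ ≤ 2 ^ κ * R x := by
    intro x
    rcases eq_or_ne (ω (Iic x)) 0 with h0 | h0
    · rw [h0, ENNReal.zero_rpow_of_pos hc, zero_mul, ENNReal.zero_rpow_of_pos hκ]; exact zero_le
    have hTx := hT x h0
    have h1 : ∫⁻ y in Ici x, ω (Iic y) ^ c ∂τ ≤
        ∫⁻ y in Ici x, R x ^ (1 / (2 * κ)) * τ (Ici y) ^ (-(1 / 2) : ℝ) ∂τ := by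
      refine setLIntegral_mono_ae' measurableSet_Ici ?_
      filter_upwards [ae_measure_Ici_ne_zero τ] with y hy hxy
      have hyt : τ (Ici y) ≠ ∞ := ne_top_of_le_ne_top hTx (measure_mono (Ici_subset_Ici.2 hxy))
      refine le_trans (le_of_eq ?_) (mul_le_mul_left (hRc x y hxy) _)
      rw [mul_assoc, ← ENNReal.rpow_add _ _ hy hyt]
      norm_num
    rw [lintegral_const_mul _ (mT.pow_const _),
      lintegral_Ici_rpow_measure_Ici τ (by norm_num) hTx] at h1
    have e1 : ENNReal.ofReal (-(1 / 2) + 1)⁻¹ = 2 := by norm_num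
    rw [e1, show (-(1 / 2) + 1 : ℝ) = 1 / 2 by norm_num] at h1
    have h2 : ω (Iic x) ^ c * ∫⁻ y in Ici x, ω (Iic y) ^ c ∂τ ≤
        2 * (R x ^ (1 / (2 * κ)) * R x ^ (1 / (2 * κ))) := by
      calc _ ≤ _ := mul_le_mul_right h1 _
        _ = 2 * (R x ^ (1 / (2 * κ)) * (ω (Iic x) ^ c * τ (Ici x) ^ (1 / 2 : ℝ))) := by ring
        _ ≤ _ := mul_le_mul_right (mul_le_mul_right (hRc x x le_rfl) _) _
    refine (ENNReal.rpow_le_rpow h2 hκ.le).trans_eq ?_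
    rw [← ENNReal.rpow_add_of_nonneg _ _ (by positivity) (by positivity),
      ENNReal.mul_rpow_of_nonneg _ _ hκ.le, ← ENNReal.rpow_mul,
      show (1 / (2 * κ) + 1 / (2 * κ)) * κ = 1 by field_simp; norm_num, ENNReal.rpow_one]
  refine (lintegral_mono hpt).trans ?_
  have mX : Measurable fun x => ω (Iic x) ^ a * τ (Ici x) ^ κ :=
    (mW.pow_const _).fun_mul (mT.pow_const _)
  have h3 : ∫⁻ x, ∫⁻ y in Ici x, τ (Ici y) ^ κ * ω (Iic y) ^ (a - 1) ∂ω ∂ω =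
      ∫⁻ x, ω (Iic x) ^ a * τ (Ici x) ^ κ ∂ω := by
    have h := lintegral_mul_setLIntegral_Iic ω ω
      ((mT.pow_const κ).fun_mul (mW.pow_const (a - 1))) (measurable_const (a := (1 : ℝ≥0∞)))
    simp only [one_mul, lintegral_const, Measure.restrict_apply_univ] at h
    rw [← h]
    refine lintegral_congr_ae ?_
    filter_upwards [ae_measure_Iic_ne_zero ω] with x hx
    rw [ENNReal.rpow_sub _ _ hx (hW x), ENNReal.rpow_one, mul_assoc, ENNReal.div_mul_cancel hx (hW x),
      mul_comm]
  rw [lintegral_const_mul _ (by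
      exact mX.add ((measurable_setLIntegral_Ici ω _).const_mul _)), mul_assoc]
  refine mul_le_mul_right (le_of_eq ?_) _
  rw [hR_def, lintegral_add_left mX, lintegral_const_mul _ (measurable_setLIntegral_Ici ω _), h3,
    ENNReal.ofReal_add zero_le_one ha.le, ENNReal.ofReal_one, add_mul, one_mul]

section
variable {p q r : ℝ} (hp : 1 < p) (hq : 0 < q) (hqp : q < p) (hr : 0 < r) (hrp : r < p)
include hp hq hqp hr hrp

/-- The part of the iterated Hardy inequality in which both variables lie above the outer one. -/
theorem exists_iterated_hardy_above_le : ∃ C : ℝ≥0∞, C ≠ ∞ ∧ ∀ (ν μ ω : Measure ℝ) [SFinite ν]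
    [SFinite μ] [SFinite ω] [NullSingletonClass ν] [NullSingletonClass μ] [NullSingletonClass ω]
    (f : ℝ → ℝ≥0∞), Measurable f →
    (∀ x, ν (Iic x) ≠ ∞) → (∀ x, ω (Iic x) ≠ ∞) → (∀ x, ω (Iic x) ≠ 0 → μ (Ici x) ≠ ∞) →
    (∀ x, ω (Iic x) ≠ 0 →
      ∫⁻ t in Ici x, μ (Ici t) ^ (r / (p - r)) * ν (Iic t) ^ ((p - 1) * r / (p - r)) ∂μ ≠ ∞) →
    ∫⁻ x, (∫⁻ t in Ici x, (∫⁻ y in Ioc x t, f y ∂ν) ^ r ∂μ) ^ (q / r) ∂ω ≤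
      C * ((∫⁻ x, ω (Iic x) ^ (q / (p - q)) *
        (∫⁻ t in Ici x, μ (Ici t) ^ (r / (p - r)) * ν (Iic t) ^ ((p - 1) * r / (p - r)) ∂μ) ^
          (q * (p - r) / (r * (p - q))) ∂ω) ^ ((p - q) / p) * (∫⁻ y, f y ^ p ∂ν) ^ (q / p)) := by
  have hpq : 0 < p - q := by linarith
  have hpr : 0 < p - r := by linarith
  have hp1 : 0 < p - 1 := by linarith
  have hp0 : 0 < p := by linarith
  obtain ⟨C₁, hC₁, hHS⟩ := exists_hardy_le hp hr hrp
  set b := (p - 1) * r / (p - r) with hb_def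
  set a := q / (p - q) with ha_def
  set ρ := r / (p - r) with hρ_def
  set κ := q * (p - r) / (r * (p - q)) with hκ_def
  set c := r / (2 * (p - r)) with hc_def
  set e := 1 / (2 * (p - 1)) with he_def
  have hb : 0 < b := by positivity
  have ha : 0 < a := by positivity
  have hρ : 0 < ρ := by positivity
  have hκ : 0 < κ := by positivity
  have hc : 0 < c := by positivity
  have he : 0 < e := by positivity
  have heb : e * b = c := by rw [he_def, hb_def, hc_def]; field_simp
  have hcκ : 2 * c * κ = a := by rw [hc_def, hκ_def, ha_def]; field_simp
  set D : ℝ≥0∞ := 2 ^ κ * ENNReal.ofReal (1 + 2 * c * κ) with hD_def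
  have hD : D ≠ ∞ := ENNReal.mul_ne_top (ENNReal.rpow_ne_top_of_nonneg hκ.le (by simp))
    ENNReal.ofReal_ne_top
  refine ⟨C₁ ^ (q / r) * (D ^ ((p - q) / p) * 2 ^ (q / p)), ?_, ?_⟩
  · exact ENNReal.mul_ne_top (ENNReal.rpow_ne_top_of_nonneg (by positivity) hC₁)
      (ENNReal.mul_ne_top (ENNReal.rpow_ne_top_of_nonneg (by positivity) hD)
        (ENNReal.rpow_ne_top_of_nonneg (by positivity) (by simp)))
  intro ν μ ω _ _ _ _ _ _ f hf hV hW hU hK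
  have mV := measurable_measure_Iic ν
  have mU := measurable_measure_Ici μ
  have mW := measurable_measure_Iic ω
  set k : ℝ → ℝ≥0∞ := fun t => μ (Ici t) ^ ρ * ν (Iic t) ^ b with hk_def
  have mk : Measurable k := (mU.pow_const _).fun_mul (mV.pow_const _)
  have hT : ∀ x, ∫⁻ t in Ici x, k t ∂μ = μ.withDensity k (Ici x) := fun x =>
    (withDensity_apply _ measurableSet_Ici).symm
  have mWe : Measurable fun y => ω (Iic y) ^ e := mW.pow_const e
  set I : ℝ → ℝ≥0∞ := fun x => ∫⁻ t in Ici x, ω (Iic t) ^ c * k t ∂μ with hI_def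
  set B : ℝ → ℝ≥0∞ := fun x => ∫⁻ y in Ici x, f y ^ p * ω (Iic y) ^ (-(1 / 2) : ℝ) ∂ν with hB_def
  have mI : Measurable I := measurable_setLIntegral_Ici μ _
  have mB : Measurable B := measurable_setLIntegral_Ici ν _
  -- Hardy's inequality above a fixed point
  have hinner : ∀ x, ω (Iic x) ≠ 0 → ∫⁻ t in Ici x, (∫⁻ y in Ioc x t, f y ∂ν) ^ r ∂μ ≤
      C₁ * (I x ^ ((p - r) / p) * B x ^ (r / p)) := by
    intro x hx
    have hWx : ∀ t, x ≤ t → ω (Iic t) ≠ 0 := fun t ht h =>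
      hx (le_antisymm (h ▸ measure_mono (Iic_subset_Iic.2 ht)) zero_le)
    set ν' := (ν.restrict (Ioi x)).withDensity (fun y => ω (Iic y) ^ e) with hν'_def
    have hν' : ∀ t, ν' (Iic t) = ∫⁻ y in Ioc x t, ω (Iic y) ^ e ∂ν := fun t => by
      rw [hν'_def, withDensity_apply _ measurableSet_Iic, Measure.restrict_restrict measurableSet_Iic,
        inter_comm, Ioi_inter_Iic]
    have hν'le : ∀ t, ν' (Iic t) ≤ ω (Iic t) ^ e * ν (Iic t) := fun t => by
      rw [hν' t, ← setLIntegral_const]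
      exact (setLIntegral_mono' measurableSet_Ioc fun y hy =>
        ENNReal.rpow_le_rpow (measure_mono (Iic_subset_Iic.2 hy.2)) he.le).trans
        (lintegral_mono_set Ioc_subset_Iic_self)
    have h := hHS ν' (μ.restrict (Ici x)) (fun y => f y * ω (Iic y) ^ (-e))
      (hf.fun_mul (mW.pow_const _))
      (fun t => ne_top_of_le_ne_top (ENNReal.mul_ne_top
        (ENNReal.rpow_ne_top_of_nonneg he.le (hW t)) (hV t)) (hν'le t))
      (fun t ht => by
        have hxt : x < t := by
          by_contra hxt
          rw [hν' t, Ioc_eq_empty hxt] at ht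
          simp at ht
        exact ne_top_of_le_ne_top (hU t (hWx t hxt.le)) (Measure.restrict_apply_le _ _))
    have e1 : ∀ t, ∫⁻ y in Iic t, f y * ω (Iic y) ^ (-e) ∂ν' = ∫⁻ y in Ioc x t, f y ∂ν := fun t => by
      rw [hν'_def, restrict_withDensity measurableSet_Iic, Measure.restrict_restrict measurableSet_Iic,
        inter_comm, Ioi_inter_Iic, lintegral_withDensity_eq_lintegral_mul _ mWe
          (hf.fun_mul (mW.pow_const _))]
      refine setLIntegral_congr_fun measurableSet_Ioc fun y hy => ?_
      simp only [Pi.mul_apply]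
      rw [mul_left_comm, ← ENNReal.rpow_add _ _ (hWx y hy.1.le) (hW y), add_neg_cancel,
        ENNReal.rpow_zero, mul_one]
    have e2 : ∫⁻ y, (f y * ω (Iic y) ^ (-e)) ^ p ∂ν' ≤ B x := by
      rw [hν'_def, lintegral_withDensity_eq_lintegral_mul _ mWe
        ((hf.fun_mul (mW.pow_const _)).pow_const p)]
      refine le_trans (setLIntegral_mono' measurableSet_Ioi fun y hy => le_of_eq ?_)
        (lintegral_mono_set Ioi_subset_Ici_self)
      simp only [Pi.mul_apply]
      rw [ENNReal.mul_rpow_of_nonneg _ _ hp0.le, ← ENNReal.rpow_mul, mul_left_comm,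
        ← ENNReal.rpow_add _ _ (hWx y (le_of_lt hy)) (hW y),
        show e + -e * p = -(1 / 2) by rw [he_def]; field_simp; ring]
    have e3 : ∫⁻ t in Ici x, (μ.restrict (Ici x)) (Ici t) ^ ρ * ν' (Iic t) ^ b ∂μ ≤ I x := by
      refine lintegral_mono fun t => ?_
      calc _ ≤ μ (Ici t) ^ ρ * (ω (Iic t) ^ e * ν (Iic t)) ^ b :=
            mul_le_mul' (ENNReal.rpow_le_rpow (Measure.restrict_apply_le _ _) hρ.le)
              (ENNReal.rpow_le_rpow (hν'le t) hb.le)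
        _ = _ := by
          rw [ENNReal.mul_rpow_of_nonneg _ _ hb.le, ← ENNReal.rpow_mul, heb]
          simp only [hk_def]; ring
    simp only [e1] at h
    exact h.trans (mul_le_mul_right (mul_le_mul' (ENNReal.rpow_le_rpow e3 (by positivity))
      (ENNReal.rpow_le_rpow e2 (by positivity))) _)
  -- the two factors in Hölder's inequality
  have hfac₁ : ∫⁻ x, (ω (Iic x) ^ c * I x) ^ κ ∂ω ≤
      D * ∫⁻ x, ω (Iic x) ^ a * (∫⁻ t in Ici x, k t ∂μ) ^ κ ∂ω := by
    have h := lintegral_rpow_mul_tail_le hc hκ (μ.withDensity k) ω hW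
      (fun x hx => hT x ▸ hK x hx)
    simp only [← hT] at h
    rw [hcκ] at h
    rw [hD_def, hcκ]
    refine le_trans (le_of_eq (lintegral_congr fun x => ?_)) h
    rw [restrict_withDensity measurableSet_Ici, lintegral_withDensity_eq_lintegral_mul _ mk
      (mW.pow_const _)]
    simp only [hI_def, Pi.mul_apply, mul_comm (k _)]
  have hfac₂ : ∫⁻ x, ω (Iic x) ^ (-(1 / 2) : ℝ) * B x ∂ω ≤ 2 * ∫⁻ y, f y ^ p ∂ν := by
    rw [hB_def, ← lintegral_mul_setLIntegral_Iic ω ν ((hf.pow_const _).fun_mul (mW.pow_const _))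
      (mW.pow_const _), ← lintegral_const_mul _ (hf.pow_const _)]
    refine lintegral_mono fun y => ?_
    rw [lintegral_Iic_rpow_measure_Iic ω (by norm_num) (hW y)]
    have e1 : ENNReal.ofReal (-(1 / 2) + 1)⁻¹ = 2 := by norm_num
    rw [e1, show (-(1 / 2) + 1 : ℝ) = 1 / 2 by norm_num]
    have e2 : ω (Iic y) ^ (-(1 / 2) : ℝ) * ω (Iic y) ^ (1 / 2 : ℝ) ≤ 1 := by
      rw [ENNReal.rpow_neg]
      exact ENNReal.inv_mul_le_one _
    calc _ = 2 * f y ^ p * (ω (Iic y) ^ (-(1 / 2) : ℝ) * ω (Iic y) ^ (1 / 2 : ℝ)) := by ring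
      _ ≤ 2 * f y ^ p * 1 := mul_le_mul_right e2 _
      _ = _ := mul_one _
  have hpt : ∀ᵐ x ∂ω, (∫⁻ t in Ici x, (∫⁻ y in Ioc x t, f y ∂ν) ^ r ∂μ) ^ (q / r) ≤
      C₁ ^ (q / r) * (((ω (Iic x) ^ c * I x) ^ κ) ^ ((p - q) / p) *
        (ω (Iic x) ^ (-(1 / 2) : ℝ) * B x) ^ (q / p)) := by
    filter_upwards [ae_measure_Iic_ne_zero ω] with x hx
    refine (ENNReal.rpow_le_rpow (hinner x hx) (by positivity)).trans_eq ?_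
    obtain ⟨t, ht⟩ := exists_eexp hx (hW x)
    rw [ht]
    simp only [eexp_rpow]
    rw [ENNReal.mul_rpow_of_nonneg C₁ _ (by positivity),
      ENNReal.mul_rpow_of_nonneg _ (B x ^ (r / p)) (by positivity), ← ENNReal.rpow_mul,
      ← ENNReal.rpow_mul (B x), ← ENNReal.rpow_mul _ κ,
      ENNReal.mul_rpow_of_nonneg _ (I x) (by positivity),
      ENNReal.mul_rpow_of_nonneg _ (B x) (by positivity), eexp_rpow, eexp_rpow,
      show (p - r) / p * (q / r) = κ * ((p - q) / p) by rw [hκ_def]; field_simp,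
      show r / p * (q / r) = q / p by field_simp]
    congr 1
    calc _ = I x ^ (κ * ((p - q) / p)) * B x ^ (q / p) * 1 := (mul_one _).symm
      _ = I x ^ (κ * ((p - q) / p)) * B x ^ (q / p) *
          (eexp (t * c * (κ * ((p - q) / p))) * eexp (t * -(1 / 2) * (q / p))) := by
        rw [eexp_mul, ← eexp_zero]
        congr 2
        rw [hc_def, hκ_def]; field_simp; ring
      _ = _ := by ring
  refine (lintegral_mono_ae hpt).trans ?_
  have m1 : Measurable fun x => (ω (Iic x) ^ c * I x) ^ κ :=
    ((mW.pow_const _).fun_mul mI).pow_const _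
  have m2 : Measurable fun x => ω (Iic x) ^ (-(1 / 2) : ℝ) * B x := (mW.pow_const _).fun_mul mB
  rw [lintegral_const_mul _ ((m1.pow_const _).fun_mul (m2.pow_const _)), mul_assoc]
  refine mul_le_mul_right ((ENNReal.lintegral_mul_norm_pow_le m1.aemeasurable m2.aemeasurable
    (by positivity) (by positivity) (by field_simp; ring)).trans ?_) _
  refine (mul_le_mul' (ENNReal.rpow_le_rpow hfac₁ (by positivity))
    (ENNReal.rpow_le_rpow hfac₂ (by positivity))).trans_eq ?_
  rw [ENNReal.mul_rpow_of_nonneg D _ (by positivity), ENNReal.mul_rpow_of_nonneg 2 _ (by positivity)]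
  ring

end

theorem ENNReal.add_rpow_le_two_rpow_mul (x y : ℝ≥0∞) {s : ℝ} (hs : 0 ≤ s) :
    (x + y) ^ s ≤ 2 ^ s * (x ^ s + y ^ s) := by
  have h : x + y ≤ 2 * max x y := by
    rw [two_mul]; exact add_le_add (le_max_left _ _) (le_max_right _ _)
  refine (ENNReal.rpow_le_rpow h hs).trans ?_
  rw [ENNReal.mul_rpow_of_nonneg _ _ hs]
  refine mul_le_mul_right ?_ _
  rcases le_total x y with h | h
  · rw [max_eq_right h]; exact le_add_self
  · rw [max_eq_left h]; exact le_self_add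

section
variable {p q r : ℝ} (hp : 1 < p) (hq : 0 < q) (hqp : q < p) (hr : 0 < r) (hrp : r < p)
include hp hq hqp hr hrp

/-- The iterated Hardy inequality with respect to atomless measures. -/
theorem exists_iterated_hardy_le : ∃ C : ℝ≥0∞, C ≠ ∞ ∧ ∀ (ν μ ω : Measure ℝ) [SFinite ν]
    [SFinite μ] [SFinite ω] [NullSingletonClass ν] [NullSingletonClass μ] [NullSingletonClass ω]
    (f : ℝ → ℝ≥0∞), Measurable f →
    (∀ x, ν (Iic x) ≠ ∞) → (∀ x, ω (Iic x) ≠ ∞) → (∀ x, ω (Iic x) ≠ 0 → μ (Ici x) ≠ ∞) →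
    (∀ x, ω (Iic x) ≠ 0 →
      ∫⁻ t in Ici x, μ (Ici t) ^ (r / (p - r)) * ν (Iic t) ^ ((p - 1) * r / (p - r)) ∂μ ≠ ∞) →
    (∀ x, ν (Iic x) ≠ 0 → ∫⁻ t in Ici x, μ (Ici t) ^ (q / r) ∂ω ≠ ∞) →
    ∫⁻ x, (∫⁻ t in Ici x, (∫⁻ y in Iic t, f y ∂ν) ^ r ∂μ) ^ (q / r) ∂ω ≤
      C * (((∫⁻ x, (∫⁻ t in Ici x, μ (Ici t) ^ (q / r) ∂ω) ^ (q / (p - q)) *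
          (μ (Ici x) ^ (q / r) * ν (Iic x) ^ ((p - 1) * q / (p - q))) ∂ω) ^ ((p - q) / p) +
        (∫⁻ x, ω (Iic x) ^ (q / (p - q)) *
          (∫⁻ t in Ici x, μ (Ici t) ^ (r / (p - r)) * ν (Iic t) ^ ((p - 1) * r / (p - r)) ∂μ) ^
            (q * (p - r) / (r * (p - q))) ∂ω) ^ ((p - q) / p)) *
        (∫⁻ y, f y ^ p ∂ν) ^ (q / p)) := by
  obtain ⟨C₁, hC₁, h₁⟩ := exists_hardy_le hp hq hqp
  obtain ⟨C₂, hC₂, h₂⟩ := exists_iterated_hardy_above_le hp hq hqp hr hrp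
  have hqr : 0 < q / r := by positivity
  set D : ℝ≥0∞ := (2 ^ r) ^ (q / r) * 2 ^ (q / r) with hD_def
  have hD : D ≠ ∞ := ENNReal.mul_ne_top (ENNReal.rpow_ne_top_of_nonneg hqr.le
    (ENNReal.rpow_ne_top_of_nonneg hr.le (by simp))) (ENNReal.rpow_ne_top_of_nonneg hqr.le (by simp))
  refine ⟨D * (C₁ + C₂), ENNReal.mul_ne_top hD (ENNReal.add_ne_top.2 ⟨hC₁, hC₂⟩), ?_⟩
  intro ν μ ω _ _ _ _ _ _ f hf hV hW hU hK hP
  have mV := measurable_measure_Iic ν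
  have mU := measurable_measure_Ici μ
  have mk : Measurable fun x => μ (Ici x) ^ (q / r) := mU.pow_const _
  set ω' := ω.withDensity fun x => μ (Ici x) ^ (q / r) with hω'_def
  set H : ℝ → ℝ≥0∞ := fun t => ∫⁻ y in Iic t, f y ∂ν with hH_def
  have mH : Measurable H := measurable_setLIntegral_Iic ν f
  have hω' : ∀ x, ω' (Ici x) = ∫⁻ t in Ici x, μ (Ici t) ^ (q / r) ∂ω := fun x =>
    withDensity_apply _ measurableSet_Ici
  have h₁' := h₁ ν ω' f hf hV fun x hx => hω' x ▸ hP x hx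
  simp only [hω'] at h₁'
  rw [hω'_def, lintegral_withDensity_eq_lintegral_mul _ mk (mH.pow_const q),
    lintegral_withDensity_eq_lintegral_mul _ mk (((measurable_setLIntegral_Ici ω _).pow_const _).fun_mul
      (mV.pow_const _))] at h₁'
  simp only [Pi.mul_apply] at h₁'
  have h₂' := h₂ ν μ ω f hf hV hW hU hK
  have hpt : ∀ x, (∫⁻ t in Ici x, H t ^ r ∂μ) ^ (q / r) ≤ D * (μ (Ici x) ^ (q / r) * H x ^ q +
      (∫⁻ t in Ici x, (∫⁻ y in Ioc x t, f y ∂ν) ^ r ∂μ) ^ (q / r)) := by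
    intro x
    have e1 : ∫⁻ t in Ici x, H t ^ r ∂μ ≤ 2 ^ r * (H x ^ r * μ (Ici x) +
        ∫⁻ t in Ici x, (∫⁻ y in Ioc x t, f y ∂ν) ^ r ∂μ) := by
      have mI : Measurable fun t => ∫⁻ y in Ioc x t, f y ∂ν :=
        Monotone.measurable fun _ _ hab => lintegral_mono_set (Ioc_subset_Ioc_right hab)
      rw [← setLIntegral_const, ← lintegral_add_left measurable_const, ← lintegral_const_mul _
        (measurable_const.fun_add (mI.pow_const r))]
      refine setLIntegral_mono' measurableSet_Ici fun t ht => ?_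
      refine le_trans (ENNReal.rpow_le_rpow ?_ hr.le) (ENNReal.add_rpow_le_two_rpow_mul _ _ hr.le)
      simp only [hH_def]
      rw [← Iic_union_Ioc_eq_Iic ht]
      exact lintegral_union_le _ _ _
    refine (ENNReal.rpow_le_rpow e1 hqr.le).trans ?_
    rw [ENNReal.mul_rpow_of_nonneg _ _ hqr.le, hD_def, mul_assoc]
    refine mul_le_mul_right ((ENNReal.add_rpow_le_two_rpow_mul _ _ hqr.le).trans_eq ?_) _
    rw [ENNReal.mul_rpow_of_nonneg _ _ hqr.le, ← ENNReal.rpow_mul, mul_div_cancel₀ _ hr.ne', mul_comm (H x ^ q)]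
  have m1 : Measurable fun x => μ (Ici x) ^ (q / r) * H x ^ q := mk.fun_mul (mH.pow_const _)
  refine (lintegral_mono hpt).trans ?_
  rw [lintegral_const_mul' _ _ hD, lintegral_add_left m1, mul_assoc D]
  refine mul_le_mul_right ((add_le_add h₁' h₂').trans ?_) _
  have e2 : ∀ x, μ (Ici x) ^ (q / r) * ((∫⁻ t in Ici x, μ (Ici t) ^ (q / r) ∂ω) ^ (q / (p - q)) *
      ν (Iic x) ^ ((p - 1) * q / (p - q))) = (∫⁻ t in Ici x, μ (Ici t) ^ (q / r) ∂ω) ^ (q / (p - q)) *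
      (μ (Ici x) ^ (q / r) * ν (Iic x) ^ ((p - 1) * q / (p - q))) := fun x => by ring
  simp only [e2]
  rw [add_mul (_ ^ _), mul_add]
  refine add_le_add (mul_le_mul_left le_self_add _) (mul_le_mul_left le_add_self _)

end

/-- A compact exhaustion of the open half line. -/
def halfLineExhaustion (n : ℕ) : Set ℝ := Icc ((n : ℝ) + 1)⁻¹ (n + 1)

theorem measurableSet_halfLineExhaustion (n : ℕ) : MeasurableSet (halfLineExhaustion n) :=
  measurableSet_Icc

theorem monotone_halfLineExhaustion : Monotone halfLineExhaustion := fun m n hmn => by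
  have h : (m : ℝ) ≤ n := by exact_mod_cast hmn
  refine Icc_subset_Icc ?_ (by linarith)
  gcongr

theorem eventually_mem_halfLineExhaustion {x : ℝ} (hx : 0 < x) :
    ∀ᶠ n in atTop, x ∈ halfLineExhaustion n := by
  filter_upwards [eventually_ge_atTop ⌈x⌉₊, eventually_ge_atTop ⌈x⁻¹⌉₊] with n h1 h2
  have h1' : x ≤ n := (Nat.le_ceil x).trans (by exact_mod_cast h1)
  have h2' : x⁻¹ ≤ n := (Nat.le_ceil _).trans (by exact_mod_cast h2)
  refine ⟨?_, by linarith⟩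
  rw [inv_le_comm₀ (by positivity) hx]
  linarith

theorem ae_pos_of_measure_Iic_zero {m : Measure ℝ} (h0 : m (Iic 0) = 0) : ∀ᵐ x ∂m, 0 < x := by
  rw [ae_iff]
  exact measure_mono_null (fun x hx => not_lt.1 hx) h0

theorem tendsto_setLIntegral_halfLineExhaustion {m : Measure ℝ} (h0 : m (Iic 0) = 0)
    {f : ℕ → ℝ → ℝ≥0∞} {g : ℝ → ℝ≥0∞} (hf : ∀ n, Measurable (f n))
    (hmono : ∀ x, Monotone fun n => f n x)
    (hlim : ∀ x, 0 < x → Tendsto (fun n => f n x) atTop (𝓝 (g x))) :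
    Tendsto (fun n => ∫⁻ x in halfLineExhaustion n, f n x ∂m) atTop (𝓝 (∫⁻ x, g x ∂m)) := by
  simp only [← lintegral_indicator (measurableSet_halfLineExhaustion _)]
  refine lintegral_tendsto_of_tendsto_of_monotone
    (fun n => ((hf n).indicator (measurableSet_halfLineExhaustion n)).aemeasurable) ?_ ?_
  · refine Eventually.of_forall fun x i j hij => ?_
    exact (indicator_le_indicator_of_subset (monotone_halfLineExhaustion hij) (fun _ => zero_le)
      x).trans (indicator_le_indicator (hmono x hij))
  · filter_upwards [ae_pos_of_measure_Iic_zero h0] with x hx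
    refine (hlim x hx).congr' ?_
    filter_upwards [eventually_mem_halfLineExhaustion hx] with n hn
    rw [indicator_of_mem hn]

theorem tendsto_restrict_halfLineExhaustion {m : Measure ℝ} (h0 : m (Iic 0) = 0) {s : Set ℝ}
    (hs : MeasurableSet s) :
    Tendsto (fun n => m.restrict (halfLineExhaustion n) s) atTop (𝓝 (m s)) := by
  have h := tendsto_setLIntegral_halfLineExhaustion (m := m.restrict s)
    (f := fun _ _ => 1) (g := fun _ => 1)
    (le_antisymm ((Measure.restrict_apply_le _ _).trans_eq h0) zero_le)
    (fun _ => measurable_const) (fun _ => monotone_const) (fun _ _ => tendsto_const_nhds)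
  simpa only [lintegral_const, Measure.restrict_apply_univ, one_mul,
    Measure.restrict_apply (measurableSet_halfLineExhaustion _), inter_comm _ s,
    Measure.restrict_apply hs] using h

theorem monotone_restrict_halfLineExhaustion (m : Measure ℝ) (s : Set ℝ) :
    Monotone fun n => m.restrict (halfLineExhaustion n) s := fun _ _ hij =>
  Measure.restrict_mono (monotone_halfLineExhaustion hij) le_rfl s

/-- The measure is carried by `(0, ∞)` and charges every initial and every final segment. -/
structure ChargesHalfLine (m : Measure ℝ) : Prop where
  null : m (Iic 0) = 0
  initial : ∀ x, 0 < x → m (Iic x) ≠ 0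
  final : ∀ x, 0 < x → m (Ici x) ≠ 0

theorem lintegral_rpow_max_le {p q r : ℝ} (hq : 0 < q) (hr : 0 < r) {C : ℝ≥0∞} {ν μ ω : Measure ℝ}
    (hC : ∀ f : ℝ → ℝ≥0∞, Measurable f →
      ∫⁻ x, (∫⁻ t in Ici x, (∫⁻ y in Iic t, f y ∂ν) ^ r ∂μ) ^ (q / r) ∂ω ≤
        C * (∫⁻ y, f y ^ p ∂ν) ^ (q / p)) (hp : 0 < p) (x : ℝ) :
    ∫⁻ y, (ν (Iic x) ^ r * μ (Ici (max x y))) ^ (q / r) ∂ω ≤ C * ν (Iic x) ^ (q / p) := by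
  have h := hC ((Iic x).indicator 1) (measurable_one.indicator measurableSet_Iic)
  have e1 : ∫⁻ y, (Iic x).indicator (1 : ℝ → ℝ≥0∞) y ^ p ∂ν = ν (Iic x) := by
    rw [← lintegral_indicator_one measurableSet_Iic]
    refine lintegral_congr fun y => ?_
    by_cases hy : y ∈ Iic x
    · simp [indicator_of_mem hy]
    · simp [indicator_of_notMem hy, hp]
  rw [e1] at h
  refine (lintegral_mono fun y => ENNReal.rpow_le_rpow ?_ (by positivity)).trans h
  rw [← setLIntegral_const]
  refine (setLIntegral_mono' measurableSet_Ici fun t ht => ?_).trans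
    (lintegral_mono_set (Ici_subset_Ici.2 (le_max_right x y)))
  refine ENNReal.rpow_le_rpow (le_of_eq ?_) hr.le
  rw [lintegral_indicator_one measurableSet_Iic, Measure.restrict_apply measurableSet_Iic,
    Iic_inter_Iic, min_eq_left ((le_max_left x y).trans ht)]

section
variable {p q r : ℝ} (hp : 1 < p) (hq : 0 < q) (hqp : q < p) (hr : 0 < r) (hrp : r < p)
include hp hq hqp hr hrp

/-- Necessity of the two integral conditions. -/
theorem conditions_of_iterated_hardy {C : ℝ≥0∞} (hCt : C ≠ ∞) {ν μ ω : Measure ℝ} [SFinite ν]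
    [SFinite μ] [SFinite ω] [NullSingletonClass ν] [NullSingletonClass μ] [NullSingletonClass ω]
    (hν : ChargesHalfLine ν) (hμ : ChargesHalfLine μ) (hω : ChargesHalfLine ω)
    (hV : ∀ x, ν (Iic x) ≠ ∞)
    (hC : ∀ f : ℝ → ℝ≥0∞, Measurable f →
      ∫⁻ x, (∫⁻ t in Ici x, (∫⁻ y in Iic t, f y ∂ν) ^ r ∂μ) ^ (q / r) ∂ω ≤
        C * (∫⁻ y, f y ^ p ∂ν) ^ (q / p)) :
    ∫⁻ x, (∫⁻ t in Ici x, μ (Ici t) ^ (q / r) ∂ω) ^ (q / (p - q)) *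
        (μ (Ici x) ^ (q / r) * ν (Iic x) ^ ((p - 1) * q / (p - q))) ∂ω ≠ ∞ ∧
      ∫⁻ x, ω (Iic x) ^ (q / (p - q)) *
        (∫⁻ t in Ici x, μ (Ici t) ^ (r / (p - r)) * ν (Iic t) ^ ((p - 1) * r / (p - r)) ∂μ) ^
          (q * (p - r) / (r * (p - q))) ∂ω ≠ ∞ := by
  have hpq : 0 < p - q := by linarith
  have hpr : 0 < p - r := by linarith
  have hp1 : 0 < p - 1 := by linarith
  have hp0 : 0 < p := by linarith
  have hqr : 0 < q / r := by positivity
  have hqp' : 0 < q / p := by positivity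
  have hθ : q / p < 1 := by rwa [div_lt_one hp0]
  have mV := measurable_measure_Iic ν
  have mU := measurable_measure_Ici μ
  have mW := measurable_measure_Iic ω
  have hmax : ∀ x, ∫⁻ y, (ν (Iic x) ^ r * μ (Ici (max x y))) ^ (q / r) ∂ω ≠ ∞ := fun x =>
    ne_top_of_le_ne_top (ENNReal.mul_ne_top hCt (ENNReal.rpow_ne_top_of_nonneg hqp'.le (hV x)))
      (lintegral_rpow_max_le hq hr hC hp0 x)
  have hVr : ∀ x, 0 < x → ν (Iic x) ^ r ≠ 0 := fun x hx h =>
    hν.initial x hx ((ENNReal.rpow_eq_zero_iff_of_pos hr).1 h)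
  have hUW : ∀ x, 0 < x → (ν (Iic x) ^ r * μ (Ici x)) ^ (q / r) * ω (Iic x) ≠ ∞ := fun x hx => by
    refine ne_top_of_le_ne_top (hmax x) ?_
    rw [← setLIntegral_const]
    refine (setLIntegral_mono' measurableSet_Iic fun y hy => ?_).trans (setLIntegral_le_lintegral _ _)
    rw [max_eq_left hy]
  have hU : ∀ x, 0 < x → μ (Ici x) ≠ ∞ := fun x hx h => hUW x hx (by
    rw [h, ENNReal.mul_top (hVr x hx), ENNReal.top_rpow_of_pos hqr, ENNReal.top_mul (hω.initial x hx)])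
  have hW : ∀ x, 0 < x → ω (Iic x) ≠ ∞ := fun x hx h => hUW x hx (by
    rw [h, ENNReal.mul_top]
    intro h'
    rcases mul_eq_zero.1 ((ENNReal.rpow_eq_zero_iff_of_pos hqr).1 h') with h' | h'
    · exact hVr x hx h'
    · exact hμ.final x hx h')
  set k : ℝ → ℝ≥0∞ := fun x => μ (Ici x) ^ (q / r) with hk_def
  have mk : Measurable k := mU.pow_const _
  set m := ω.withDensity k with hm_def
  have hm : ∀ x, m (Ici x) = ∫⁻ t in Ici x, k t ∂ω := fun x => withDensity_apply _ measurableSet_Ici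
  have hm0 : m (Iic 0) = 0 := withDensity_absolutelyContinuous _ _ hω.null
  have hmt : ∀ x, 0 < x → m (Ici x) ≠ ∞ := fun x hx h => by
    rw [hm x] at h
    have h2 : (ν (Iic x) ^ r) ^ (q / r) * ∫⁻ t in Ici x, k t ∂ω ≠ ∞ := by
      refine ne_top_of_le_ne_top (hmax x) ?_
      rw [← lintegral_const_mul _ mk]
      refine (setLIntegral_mono' measurableSet_Ici fun y hy => ?_).trans
        (setLIntegral_le_lintegral _ _)
      rw [max_eq_right hy, ENNReal.mul_rpow_of_nonneg _ _ hqr.le]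
    refine h2 ?_
    rw [h, ENNReal.mul_top]
    exact fun h' => hVr x hx ((ENNReal.rpow_eq_zero_iff_of_pos hqr).1 h')
  have hn0 : ∀ n : ℕ, 0 < ((n : ℝ) + 1)⁻¹ := fun n => by positivity
  have hsub : ∀ n, halfLineExhaustion n ⊆ Ici ((n : ℝ) + 1)⁻¹ := fun n => Icc_subset_Ici_self
  have hsub' : ∀ n : ℕ, halfLineExhaustion n ⊆ Iic ((n : ℝ) + 1) := fun n => Icc_subset_Iic_self
  have hVn : ∀ n : ℕ, ∀ x ∈ halfLineExhaustion n, ν (Iic x) ≤ ν (Iic ((n : ℝ) + 1)) := fun n x hx =>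
    measure_mono (Iic_subset_Iic.2 (hsub' n hx))
  have hle_univ : ∀ (τ : Measure ℝ) n s, τ.restrict (halfLineExhaustion n) s ≤
      τ (halfLineExhaustion n) := fun τ n s =>
    (measure_mono (subset_univ s)).trans_eq (Measure.restrict_apply_univ _)
  have hmn : ∀ n, m (halfLineExhaustion n) ≠ ∞ := fun n =>
    ne_top_of_le_ne_top (hmt _ (hn0 n)) (measure_mono (hsub n))
  have hμn : ∀ n, μ (halfLineExhaustion n) ≠ ∞ := fun n =>
    ne_top_of_le_ne_top (hU _ (hn0 n)) (measure_mono (hsub n))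
  have hωn : ∀ n, ω (halfLineExhaustion n) ≠ ∞ := fun n =>
    ne_top_of_le_ne_top (hW _ (by positivity)) (measure_mono (hsub' n))
  constructor
  · set a := q / (p - q) with ha_def
    set b := (p - 1) * q / (p - q) with hb_def
    have ha : 0 < a := by positivity
    have hb : 0 < b := by positivity
    obtain ⟨C₁, hC₁, h₁⟩ := exists_le_hardy hp hq hqp
    have hfin : (∫⁻ x, m (Ici x) ^ a * ν (Iic x) ^ b ∂m) ≠ ∞ := by
      set A : ℝ≥0∞ := (C₁ * (C * C₁ ^ (q / p))) ^ (1 / (1 - q / p)) with hA_def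
      have hA : A ≠ ∞ := ENNReal.rpow_ne_top_of_nonneg (by
          rw [one_div, inv_nonneg]; linarith)
        (ENNReal.mul_ne_top hC₁ (ENNReal.mul_ne_top hCt
          (ENNReal.rpow_ne_top_of_nonneg hqp'.le hC₁)))
      refine ne_top_of_le_ne_top hA ?_
      refine le_of_tendsto' (tendsto_setLIntegral_halfLineExhaustion hm0
        (f := fun n x => m.restrict (halfLineExhaustion n) (Ici x) ^ a * ν (Iic x) ^ b)
        (fun n => ((measurable_measure_Ici _).pow_const _).fun_mul (mV.pow_const _))
        (fun x i j hij => mul_le_mul_left (ENNReal.rpow_le_rpow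
          (monotone_restrict_halfLineExhaustion m _ hij) ha.le) _)
        fun x hx => ENNReal.Tendsto.mul_const ((ENNReal.continuous_rpow_const.tendsto _).comp
          (tendsto_restrict_halfLineExhaustion hm0 measurableSet_Ici))
          (Or.inr (ENNReal.rpow_ne_top_of_nonneg hb.le (hV x)))) fun n => ?_
      obtain ⟨f, mf, hf1, hf2⟩ := h₁ ν (m.restrict (halfLineExhaustion n)) hV
        (fun x => ne_top_of_le_ne_top (hmn n) (hle_univ m n _))
      refine ENNReal.le_rpow_of_le_mul_rpow hθ ?_ ?_
      · refine ne_top_of_le_ne_top ?_ (setLIntegral_mono' (g := fun _ =>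
          m (halfLineExhaustion n) ^ a * ν (Iic ((n : ℝ) + 1)) ^ b)
          (measurableSet_halfLineExhaustion n) fun x hx => mul_le_mul'
            (ENNReal.rpow_le_rpow (hle_univ m n _) ha.le)
            (ENNReal.rpow_le_rpow (hVn n x hx) hb.le))
        rw [setLIntegral_const]
        exact ENNReal.mul_ne_top (ENNReal.mul_ne_top (ENNReal.rpow_ne_top_of_nonneg ha.le (hmn n))
          (ENNReal.rpow_ne_top_of_nonneg hb.le (hV _))) (hmn n)
      · refine hf2.trans ?_
        rw [mul_assoc]
        refine mul_le_mul_right ?_ _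
        have mH := measurable_setLIntegral_Iic ν f
        calc _ ≤ ∫⁻ x, (∫⁻ y in Iic x, f y ∂ν) ^ q ∂m := setLIntegral_le_lintegral _ _
          _ = ∫⁻ x, ((∫⁻ y in Iic x, f y ∂ν) ^ r * μ (Ici x)) ^ (q / r) ∂ω := by
            rw [hm_def, lintegral_withDensity_eq_lintegral_mul _ mk (mH.pow_const q)]
            refine lintegral_congr fun x => ?_
            rw [Pi.mul_apply, ENNReal.mul_rpow_of_nonneg _ _ hqr.le, ← ENNReal.rpow_mul,
              mul_div_cancel₀ _ hr.ne', mul_comm]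
          _ ≤ ∫⁻ x, (∫⁻ t in Ici x, (∫⁻ y in Iic t, f y ∂ν) ^ r ∂μ) ^ (q / r) ∂ω := by
            refine lintegral_mono fun x => ENNReal.rpow_le_rpow ?_ hqr.le
            rw [← setLIntegral_const]
            exact setLIntegral_mono' measurableSet_Ici fun t ht =>
              ENNReal.rpow_le_rpow (lintegral_mono_set (Iic_subset_Iic.2 ht)) hr.le
          _ ≤ C * (∫⁻ y, f y ^ p ∂ν) ^ (q / p) := hC f mf
          _ ≤ C * (C₁ * _) ^ (q / p) := mul_le_mul_right (ENNReal.rpow_le_rpow hf1 hqp'.le) _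
          _ = _ := by rw [ENNReal.mul_rpow_of_nonneg _ _ hqp'.le, mul_assoc]
    rw [hm_def, lintegral_withDensity_eq_lintegral_mul _ mk
      (((measurable_measure_Ici _).pow_const _).fun_mul (mV.pow_const _)), ← hm_def] at hfin
    simp only [Pi.mul_apply, hm, hk_def] at hfin
    simpa only [mul_left_comm] using hfin
  · set a := q / (p - q) with ha_def
    set b := (p - 1) * r / (p - r) with hb_def
    set ρ := r / (p - r) with hρ_def
    set κ := q * (p - r) / (r * (p - q)) with hκ_def
    have ha : 0 < a := by positivity
    have hb : 0 < b := by positivity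
    have hρ : 0 < ρ := by positivity
    have hκ : 0 < κ := by positivity
    obtain ⟨C₁, hC₁, h₁⟩ := exists_le_iterated_hardy hp hq hqp hr hrp
    set A : ℝ≥0∞ := (C₁ * (C * C₁ ^ (q / p))) ^ (1 / (1 - q / p)) with hA_def
    have hA : A ≠ ∞ := ENNReal.rpow_ne_top_of_nonneg (by
        rw [one_div, inv_nonneg]; linarith)
      (ENNReal.mul_ne_top hC₁ (ENNReal.mul_ne_top hCt
        (ENNReal.rpow_ne_top_of_nonneg hqp'.le hC₁)))
    refine ne_top_of_le_ne_top hA ?_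
    set μ' : ℕ → Measure ℝ := fun n => μ.restrict (halfLineExhaustion n) with hμ'_def
    set ω' : ℕ → Measure ℝ := fun n => ω.restrict (halfLineExhaustion n) with hω'_def
    set K : ℕ → ℝ → ℝ≥0∞ := fun n x =>
      ∫⁻ t in Ici x, μ' n (Ici t) ^ ρ * ν (Iic t) ^ b ∂(μ' n) with hK_def
    have mk' : ∀ n, Measurable fun t => μ' n (Ici t) ^ ρ * ν (Iic t) ^ b := fun n =>
      ((measurable_measure_Ici _).pow_const _).fun_mul (mV.pow_const _)
    have hKS : ∀ n x, K n x = ∫⁻ t in halfLineExhaustion n, μ' n (Ici t) ^ ρ * ν (Iic t) ^ b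
        ∂(μ.restrict (Ici x)) := fun n x => by
      simp only [hK_def, hμ'_def]
      rw [Measure.restrict_restrict measurableSet_Ici,
        Measure.restrict_restrict (measurableSet_halfLineExhaustion n), inter_comm]
    have hkmono : ∀ t, Monotone fun n => μ' n (Ici t) ^ ρ * ν (Iic t) ^ b := fun t i j hij =>
      mul_le_mul_left (ENNReal.rpow_le_rpow (monotone_restrict_halfLineExhaustion μ _ hij) hρ.le) _
    have hKlim : ∀ x, Tendsto (fun n => K n x) atTop
        (𝓝 (∫⁻ t in Ici x, μ (Ici t) ^ ρ * ν (Iic t) ^ b ∂μ)) := fun x => by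
      simp only [hKS]
      refine tendsto_setLIntegral_halfLineExhaustion
        (le_antisymm ((Measure.restrict_apply_le _ _).trans_eq hμ.null) zero_le) mk' hkmono
        fun t _ => ENNReal.Tendsto.mul_const ((ENNReal.continuous_rpow_const.tendsto _).comp
          (tendsto_restrict_halfLineExhaustion hμ.null measurableSet_Ici))
          (Or.inr (ENNReal.rpow_ne_top_of_nonneg hb.le (hV t)))
    have hKmono : ∀ x, Monotone fun n => K n x := fun x i j hij =>
      lintegral_mono' (Measure.restrict_mono le_rfl
        (Measure.restrict_mono (monotone_halfLineExhaustion hij) le_rfl)) fun t => hkmono t hij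
    have hKx : ∀ n x, K n x ≤ μ (halfLineExhaustion n) ^ ρ * ν (Iic ((n : ℝ) + 1)) ^ b *
        μ (halfLineExhaustion n) := fun n x => by
      rw [← setLIntegral_const]
      exact (setLIntegral_le_lintegral _ _).trans (setLIntegral_mono'
        (measurableSet_halfLineExhaustion n) fun t ht => mul_le_mul'
          (ENNReal.rpow_le_rpow (hle_univ μ n _) hρ.le)
          (ENNReal.rpow_le_rpow (hVn n t ht) hb.le))
    have hKn : ∀ n, μ (halfLineExhaustion n) ^ ρ * ν (Iic ((n : ℝ) + 1)) ^ b *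
        μ (halfLineExhaustion n) ≠ ∞ := fun n =>
      ENNReal.mul_ne_top (ENNReal.mul_ne_top (ENNReal.rpow_ne_top_of_nonneg hρ.le (hμn n))
        (ENNReal.rpow_ne_top_of_nonneg hb.le (hV _))) (hμn n)
    refine le_of_tendsto' (tendsto_setLIntegral_halfLineExhaustion hω.null
      (f := fun n x => ω' n (Iic x) ^ a * K n x ^ κ)
      (fun n => ((measurable_measure_Iic _).pow_const _).fun_mul
        ((measurable_setLIntegral_Ici _ _).pow_const _))
      (fun x i j hij => mul_le_mul' (ENNReal.rpow_le_rpow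
        (monotone_restrict_halfLineExhaustion ω _ hij) ha.le)
        (ENNReal.rpow_le_rpow (hKmono x hij) hκ.le))
      fun x hx => ENNReal.Tendsto.mul ((ENNReal.continuous_rpow_const.tendsto _).comp
        (tendsto_restrict_halfLineExhaustion hω.null measurableSet_Iic))
        (Or.inl fun h => hω.initial x hx ((ENNReal.rpow_eq_zero_iff_of_pos ha).1 h))
        ((ENNReal.continuous_rpow_const.tendsto _).comp (hKlim x))
        (Or.inr (ENNReal.rpow_ne_top_of_nonneg ha.le (hW x hx)))) fun n => ?_
    obtain ⟨f, mf, hf1, hf2⟩ := h₁ ν (μ' n) (ω' n) hV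
      (fun x => ne_top_of_le_ne_top (hμn n) (hle_univ μ n _))
      (fun x => ne_top_of_le_ne_top (hωn n) (hle_univ ω n _))
      (fun x => ne_top_of_le_ne_top (hKn n) (hKx n x))
    refine ENNReal.le_rpow_of_le_mul_rpow hθ ?_ ?_
    · refine ne_top_of_le_ne_top ?_ (lintegral_mono (g := fun _ => ω (halfLineExhaustion n) ^ a *
        (μ (halfLineExhaustion n) ^ ρ * ν (Iic ((n : ℝ) + 1)) ^ b * μ (halfLineExhaustion n)) ^ κ)
        fun x => mul_le_mul' (ENNReal.rpow_le_rpow (hle_univ ω n _) ha.le)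
          (ENNReal.rpow_le_rpow (hKx n x) hκ.le))
      rw [setLIntegral_const]
      exact ENNReal.mul_ne_top (ENNReal.mul_ne_top (ENNReal.rpow_ne_top_of_nonneg ha.le (hωn n))
        (ENNReal.rpow_ne_top_of_nonneg hκ.le (hKn n))) (hωn n)
    · refine hf2.trans ?_
      rw [mul_assoc]
      refine mul_le_mul_right ?_ _
      calc _ ≤ ∫⁻ x, (∫⁻ t in Ici x, (∫⁻ y in Iic t, f y ∂ν) ^ r ∂μ) ^ (q / r) ∂ω :=
            lintegral_mono' Measure.restrict_le_self fun x => ENNReal.rpow_le_rpow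
              (lintegral_mono' (Measure.restrict_mono le_rfl Measure.restrict_le_self) le_rfl) hqr.le
        _ ≤ C * (∫⁻ y, f y ^ p ∂ν) ^ (q / p) := hC f mf
        _ ≤ C * (C₁ * _) ^ (q / p) := mul_le_mul_right (ENNReal.rpow_le_rpow hf1 hqp'.le) _
        _ = _ := by rw [ENNReal.mul_rpow_of_nonneg _ _ hqp'.le, mul_assoc]

end

theorem ChargesHalfLine.exists_le {m : Measure ℝ} (hm : ChargesHalfLine m) {P : ℝ → Prop}
    (hP : ∀ᵐ x ∂m, P x) {x : ℝ} (hx : 0 < x) : ∃ y, 0 < y ∧ y ≤ x ∧ P y := by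
  by_contra! h
  refine hm.initial x hx (measure_mono_null (fun y hy => ?_)
    (ae_iff.1 (hP.and (ae_pos_of_measure_Iic_zero hm.null))))
  exact fun h' => h y h'.2 hy h'.1

theorem ChargesHalfLine.exists_ge {m : Measure ℝ} (hm : ChargesHalfLine m) {P : ℝ → Prop}
    (hP : ∀ᵐ x ∂m, P x) {x : ℝ} (hx : 0 < x) : ∃ y, x ≤ y ∧ P y := by
  by_contra! h
  exact hm.final x hx (measure_mono_null (fun y hy => h y hy) (ae_iff.1 hP))

theorem ChargesHalfLine.setLIntegral_Ici_ne_zero {m : Measure ℝ} (hm : ChargesHalfLine m)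
    {f : ℝ → ℝ≥0∞} (mf : Measurable f) (hf : ∀ x, 0 < x → f x ≠ 0) {x : ℝ} (hx : 0 < x) :
    ∫⁻ t in Ici x, f t ∂m ≠ 0 := by
  rw [Ne, setLIntegral_eq_zero_iff measurableSet_Ici mf]
  intro h
  obtain ⟨y, hxy, h'⟩ := hm.exists_ge h hx
  exact hf y (hx.trans_le hxy) (h' hxy)

section
variable {p q r : ℝ} (hp : 1 < p) (hq : 0 < q) (hqp : q < p) (hr : 0 < r) (hrp : r < p)
include hp hq hqp hr hrp

/-- Characterization of the iterated Hardy inequality for measures on the half line. -/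
theorem iterated_hardy_iff {ν μ ω : Measure ℝ} [SFinite ν]
    [SFinite μ] [SFinite ω] [NullSingletonClass ν] [NullSingletonClass μ] [NullSingletonClass ω]
    (hν : ChargesHalfLine ν) (hμ : ChargesHalfLine μ) (hω : ChargesHalfLine ω)
    (hV : ∀ x, ν (Iic x) ≠ ∞) :
    (∃ C : ℝ≥0∞, C ≠ ∞ ∧ ∀ f : ℝ → ℝ≥0∞, Measurable f →
      ∫⁻ x, (∫⁻ t in Ici x, (∫⁻ y in Iic t, f y ∂ν) ^ r ∂μ) ^ (q / r) ∂ω ≤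
        C * (∫⁻ y, f y ^ p ∂ν) ^ (q / p)) ↔
    ∫⁻ x, (∫⁻ t in Ici x, μ (Ici t) ^ (q / r) ∂ω) ^ (q / (p - q)) *
        (μ (Ici x) ^ (q / r) * ν (Iic x) ^ ((p - 1) * q / (p - q))) ∂ω ≠ ∞ ∧
      ∫⁻ x, ω (Iic x) ^ (q / (p - q)) *
        (∫⁻ t in Ici x, μ (Ici t) ^ (r / (p - r)) * ν (Iic t) ^ ((p - 1) * r / (p - r)) ∂μ) ^
          (q * (p - r) / (r * (p - q))) ∂ω ≠ ∞ := by
  refine ⟨fun ⟨C, hCt, hC⟩ => conditions_of_iterated_hardy hp hq hqp hr hrp hCt hν hμ hω hV hC,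
    fun ⟨hF, hX⟩ => ?_⟩
  have hpq : 0 < p - q := by linarith
  have hpr : 0 < p - r := by linarith
  have hp1 : 0 < p - 1 := by linarith
  have hp0 : 0 < p := by linarith
  have hqr : 0 < q / r := by positivity
  have ha : 0 < q / (p - q) := by positivity
  have hb : 0 < (p - 1) * q / (p - q) := by positivity
  have hρ : 0 < r / (p - r) := by positivity
  have hβ : 0 < (p - 1) * r / (p - r) := by positivity
  have hκ : 0 < q * (p - r) / (r * (p - q)) := by positivity
  have mV := measurable_measure_Iic ν
  have mU := measurable_measure_Ici μ
  have mW := measurable_measure_Iic ω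
  have rpow_ne_zero : ∀ {a : ℝ≥0∞} {s : ℝ}, 0 < s → a ≠ 0 → a ^ s ≠ 0 := fun hs h h' =>
    h ((ENNReal.rpow_eq_zero_iff_of_pos hs).1 h')
  have ne_top_of_rpow : ∀ {a : ℝ≥0∞} {s : ℝ}, 0 < s → a ^ s ≠ ∞ → a ≠ ∞ := fun hs h h' =>
    h (by rw [h', ENNReal.top_rpow_of_pos hs])
  have ne_top_left : ∀ {a b : ℝ≥0∞}, a * b ≠ ∞ → b ≠ 0 → a ≠ ∞ := fun h hb h' =>
    h (by rw [h', ENNReal.top_mul hb])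
  have ne_top_right : ∀ {a b : ℝ≥0∞}, a * b ≠ ∞ → a ≠ 0 → b ≠ ∞ := fun h hb h' =>
    h (by rw [h', ENNReal.mul_top hb])
  have hPsi0 : ∀ x, 0 < x → ∫⁻ t in Ici x, μ (Ici t) ^ (q / r) ∂ω ≠ 0 := fun x hx =>
    hω.setLIntegral_Ici_ne_zero (mU.pow_const _) (fun t ht => rpow_ne_zero hqr (hμ.final t ht)) hx
  have mk : Measurable fun t => μ (Ici t) ^ (r / (p - r)) * ν (Iic t) ^ ((p - 1) * r / (p - r)) :=
    (mU.pow_const _).fun_mul (mV.pow_const _)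
  have hK0 : ∀ x, 0 < x → ∫⁻ t in Ici x, μ (Ici t) ^ (r / (p - r)) *
      ν (Iic t) ^ ((p - 1) * r / (p - r)) ∂μ ≠ 0 := fun x hx =>
    hμ.setLIntegral_Ici_ne_zero mk (fun t ht =>
      mul_ne_zero (rpow_ne_zero hρ (hμ.final t ht)) (rpow_ne_zero hβ (hν.initial t ht))) hx
  have hFae := ae_lt_top (((measurable_setLIntegral_Ici ω _).pow_const _).fun_mul
    ((mU.pow_const _).fun_mul (mV.pow_const _))) hF
  have hXae := ae_lt_top ((mW.pow_const _).fun_mul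
    ((measurable_setLIntegral_Ici μ _).pow_const _)) hX
  have hpos : ∀ {m : Measure ℝ} {x}, ChargesHalfLine m → m (Iic x) ≠ 0 → 0 < x := fun hm h => by
    by_contra! hx
    exact h (measure_mono_null (Iic_subset_Iic.2 hx) hm.null)
  have hUΨ : ∀ x, 0 < x → μ (Ici x) ≠ ∞ ∧ ∫⁻ t in Ici x, μ (Ici t) ^ (q / r) ∂ω ≠ ∞ :=
      fun x hx => by
    obtain ⟨y, hy, hyx, h⟩ := hω.exists_le hFae hx
    have hV0 := rpow_ne_zero hb (hν.initial y hy)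
    have hU0 := rpow_ne_zero hqr (hμ.final y hy)
    exact ⟨ne_top_of_le_ne_top (ne_top_of_rpow hqr (ne_top_left (ne_top_right h.ne
        (rpow_ne_zero ha (hPsi0 y hy))) hV0)) (measure_mono (Ici_subset_Ici.2 hyx)),
      ne_top_of_le_ne_top (ne_top_of_rpow ha (ne_top_left h.ne (mul_ne_zero hU0 hV0)))
        (lintegral_mono_set (Ici_subset_Ici.2 hyx))⟩
  have hW : ∀ x, ω (Iic x) ≠ ∞ := fun x h => by
    have hx := hpos hω (x := x) (by simp [h])
    obtain ⟨y, hxy, h'⟩ := hω.exists_ge hXae hx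
    exact ne_top_of_le_ne_top (ne_top_of_rpow ha (ne_top_left h'.ne
      (rpow_ne_zero hκ (hK0 y (hx.trans_le hxy))))) (measure_mono (Iic_subset_Iic.2 hxy)) h
  obtain ⟨C, hCt, hC⟩ := exists_iterated_hardy_le hp hq hqp hr hrp
  refine ⟨_, ENNReal.mul_ne_top hCt (ENNReal.add_ne_top.2
    ⟨ENNReal.rpow_ne_top_of_nonneg (div_pos hpq hp0).le hF,
      ENNReal.rpow_ne_top_of_nonneg (div_pos hpq hp0).le hX⟩), fun f mf => ?_⟩
  rw [mul_assoc]
  refine hC ν μ ω f mf hV hW (fun x hx => (hUΨ x (hpos hω hx)).1) (fun x hx => ?_)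
    fun x hx => (hUΨ x (hpos hν hx)).2
  obtain ⟨y, hy, hyx, h⟩ := hω.exists_le hXae (hpos hω hx)
  exact ne_top_of_le_ne_top (ne_top_of_rpow hκ (ne_top_right h.ne
    (rpow_ne_zero ha (hω.initial y hy)))) (lintegral_mono_set (Ici_subset_Ici.2 hyx))

end

instance : SFinite mu0 := inferInstanceAs (SFinite (volume.restrict (Ioi (0 : ℝ))))

instance : NullSingletonClass mu0 :=
  inferInstanceAs (NullSingletonClass (volume.restrict (Ioi (0 : ℝ))))

theorem lintegral_withDensity_mu0 {u g : ℝ → ℝ≥0∞} (mu : Measurable u) (mg : Measurable g) :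
    ∫⁻ x, g x ∂(mu0.withDensity u) = ∫⁻ x in Ioi (0 : ℝ), g x * u x := by
  rw [lintegral_withDensity_eq_lintegral_mul _ mu mg]
  simp only [Pi.mul_apply, mul_comm, mu0]

theorem setLIntegral_Ici_withDensity_mu0 {u g : ℝ → ℝ≥0∞} (mu : Measurable u) (mg : Measurable g)
    {x : ℝ} (hx : 0 < x) :
    ∫⁻ t in Ici x, g t ∂(mu0.withDensity u) = ∫⁻ t in Ioi x, g t * u t := by
  rw [restrict_withDensity measurableSet_Ici, lintegral_withDensity_eq_lintegral_mul _ mu mg, mu0,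
    Measure.restrict_restrict measurableSet_Ici,
    inter_eq_left.2 (Ici_subset_Ioi.2 hx), Measure.restrict_congr_set Ioi_ae_eq_Ici.symm]
  simp only [Pi.mul_apply, mul_comm]

theorem setLIntegral_Iic_withDensity_mu0 {u g : ℝ → ℝ≥0∞} (mu : Measurable u) (mg : Measurable g)
    (x : ℝ) : ∫⁻ t in Iic x, g t ∂(mu0.withDensity u) = ∫⁻ t in Ioc 0 x, g t * u t := by
  rw [restrict_withDensity measurableSet_Iic, lintegral_withDensity_eq_lintegral_mul _ mu mg, mu0,
    Measure.restrict_restrict measurableSet_Iic, inter_comm, Ioi_inter_Iic]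
  simp only [Pi.mul_apply, mul_comm]

theorem withDensity_mu0_Ici {u : ℝ → ℝ≥0∞} (mu : Measurable u) {x : ℝ} (hx : 0 < x) :
    mu0.withDensity u (Ici x) = ∫⁻ t in Ioi x, u t := by
  simpa using setLIntegral_Ici_withDensity_mu0 mu (measurable_const (a := (1 : ℝ≥0∞))) hx

theorem withDensity_mu0_Iic {u : ℝ → ℝ≥0∞} (mu : Measurable u) (x : ℝ) :
    mu0.withDensity u (Iic x) = ∫⁻ t in Ioc 0 x, u t := by
  simpa using setLIntegral_Iic_withDensity_mu0 mu (measurable_const (a := (1 : ℝ≥0∞))) x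

theorem IsWeight.chargesHalfLine {u : ℝ → ℝ≥0∞} (hu : IsWeight u) :
    ChargesHalfLine (mu0.withDensity u) := by
  have key : ∀ s : Set ℝ, MeasurableSet s → mu0.withDensity u s = 0 → mu0 s = 0 := fun s hs h => by
    rw [withDensity_apply _ hs, setLIntegral_eq_zero_iff hs hu.1] at h
    refine measure_mono_null (fun x hx => ?_) (ae_iff.1 (h.and hu.2))
    exact fun h' => h'.2.1.ne' (h'.1 hx)
  refine ⟨?_, fun x hx h => ?_, fun _ hx h => ?_⟩
  · simp [withDensity_mu0_Iic hu.1]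
  · have := key _ measurableSet_Iic h
    rw [mu0, Measure.restrict_apply measurableSet_Iic, inter_comm, Ioi_inter_Iic,
      Real.volume_Ioc] at this
    simp [hx.not_ge] at this
  · have := key _ measurableSet_Ici h
    rw [mu0, Measure.restrict_apply measurableSet_Ici, inter_eq_left.2 (Ici_subset_Ioi.2 hx),
      Real.volume_Ici] at this
    simp at this

theorem IsWeight.rpow {v : ℝ → ℝ≥0∞} (hv : IsWeight v) (s : ℝ) : IsWeight fun x => v x ^ s :=
  ⟨hv.1.pow_const s, hv.2.mono fun _ hx => ⟨ENNReal.rpow_pos hx.1 hx.2.ne,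
    (ENNReal.rpow_ne_top_of_ne_zero hx.1.ne' hx.2.ne).lt_top⟩⟩

theorem ENNReal.rpow_dual_mul_self {p : ℝ} (hp : 1 < p) {x : ℝ≥0∞} (h0 : x ≠ 0) (hx : x ≠ ∞) :
    (x ^ (1 - p / (p - 1))) ^ p * x = x ^ (1 - p / (p - 1)) := by
  have hp1 : p - 1 ≠ 0 := by linarith
  conv_lhs => rw [← ENNReal.rpow_mul, ← ENNReal.rpow_one x, ← ENNReal.rpow_mul,
    ← ENNReal.rpow_add _ _ h0 hx]
  congr 1
  field_simp
  ring

theorem ENNReal.rpow_lt_top_iff_ne_top {x : ℝ≥0∞} {s : ℝ} (hs : 0 < s) : x ^ s < ∞ ↔ x ≠ ∞ := by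
  rw [ENNReal.rpow_lt_top_iff_of_pos hs, lt_top_iff_ne_top]

theorem statement15 (p q r : ℝ) (hq : 0 < q) (hr : 0 < r) (hp : 1 < p) (hqp : q < p) (hrp : r < p)
    (u w v : ℝ → ℝ≥0∞) (hu : IsWeight u) (hw : IsWeight w) (hv : IsWeight v)
    (hvfin : ∀ x ∈ Ioi (0 : ℝ), (∫⁻ t in Ioc (0 : ℝ) x, v t ^ (1 - p / (p - 1))) < ∞) :
    (∃ C : ℝ≥0, 0 < C ∧ ∀ h : ℝ → ℝ≥0∞, Measurable h →
        (∫⁻ x in Ioi (0 : ℝ),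
            (∫⁻ t in Ioi x, (∫⁻ s in Ioc (0 : ℝ) t, h s) ^ r * u t) ^ (q / r) * w x) ^
          (1 / q) ≤
          (C : ℝ≥0∞) * (∫⁻ t in Ioi (0 : ℝ), h t ^ p * v t) ^ (1 / p)) ↔
      (((∫⁻ x in Ioi (0 : ℝ),
        (∫⁻ t in Ioi x, (∫⁻ s in Ioi t, u s) ^ (q / r) * w t) ^ (q / (p - q)) *
          ((∫⁻ t in Ioi x, u t) ^ (q / r) *
            ((∫⁻ t in Ioc (0 : ℝ) x, v t ^ (1 - p / (p - 1))) ^ ((p - 1) * q / (p - q)) *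
              w x))) ^ ((p - q) / (p * q))) < ∞ ∧
      ((∫⁻ t in Ioi (0 : ℝ),
        (∫⁻ s in Ioc (0 : ℝ) t, w s) ^ (q / (p - q)) * w t *
          (∫⁻ x in Ioi t,
              (∫⁻ s in Ioi x, u s) ^ (r / (p - r)) * u x *
                (∫⁻ s in Ioc (0 : ℝ) x, v s ^ (1 - p / (p - 1))) ^ ((p - 1) * r / (p - r))) ^
            (q * (p - r) / (r * (p - q)))) ^ ((p - q) / (p * q))) < ∞) := by
  have hp0 : 0 < p := by linarith
  have hpq : 0 < p - q := by linarith
  have hs : 0 < (p - q) / (p * q) := by positivity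
  set σ : ℝ → ℝ≥0∞ := fun x => v x ^ (1 - p / (p - 1)) with hσ_def
  have hσ : IsWeight σ := hv.rpow _
  set ν := mu0.withDensity σ with hν_def
  set μ := mu0.withDensity u with hμ_def
  set ω := mu0.withDensity w with hω_def
  have hV : ∀ x, ν (Iic x) = ∫⁻ t in Ioc 0 x, σ t := withDensity_mu0_Iic hσ.1
  have hW : ∀ x, ω (Iic x) = ∫⁻ t in Ioc 0 x, w t := withDensity_mu0_Iic hw.1
  have hU : ∀ x, 0 < x → μ (Ici x) = ∫⁻ t in Ioi x, u t := fun x hx =>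
    withDensity_mu0_Ici hu.1 hx
  have mV := measurable_measure_Iic ν
  have mU := measurable_measure_Ici μ
  have mW := measurable_measure_Iic ω
  have hVt : ∀ x, ν (Iic x) ≠ ∞ := fun x => by
    rw [hV]
    rcases le_or_gt x 0 with hx | hx
    · simp [hx]
    · exact (hvfin x hx).ne
  have hF4 : ∫⁻ x in Ioi (0 : ℝ),
        (∫⁻ t in Ioi x, (∫⁻ s in Ioi t, u s) ^ (q / r) * w t) ^ (q / (p - q)) *
          ((∫⁻ t in Ioi x, u t) ^ (q / r) *
            ((∫⁻ t in Ioc (0 : ℝ) x, σ t) ^ ((p - 1) * q / (p - q)) * w x)) =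
      ∫⁻ x, (∫⁻ t in Ici x, μ (Ici t) ^ (q / r) ∂ω) ^ (q / (p - q)) *
        (μ (Ici x) ^ (q / r) * ν (Iic x) ^ ((p - 1) * q / (p - q))) ∂ω := by
    rw [hω_def, lintegral_withDensity_mu0 hw.1 (((measurable_setLIntegral_Ici _ _).pow_const _).fun_mul
      ((mU.pow_const _).fun_mul (mV.pow_const _)))]
    refine setLIntegral_congr_fun measurableSet_Ioi fun x hx => ?_
    rw [setLIntegral_Ici_withDensity_mu0 hw.1 (mU.pow_const _) hx, hU x hx, hV, mul_assoc, mul_assoc]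
    congr 2
    exact setLIntegral_congr_fun measurableSet_Ioi fun t ht => by rw [hU t (hx.trans ht)]
  have hF6 : ∫⁻ t in Ioi (0 : ℝ),
        (∫⁻ s in Ioc (0 : ℝ) t, w s) ^ (q / (p - q)) * w t *
          (∫⁻ x in Ioi t, (∫⁻ s in Ioi x, u s) ^ (r / (p - r)) * u x *
                (∫⁻ s in Ioc (0 : ℝ) x, σ s) ^ ((p - 1) * r / (p - r))) ^
            (q * (p - r) / (r * (p - q))) =
      ∫⁻ x, ω (Iic x) ^ (q / (p - q)) *
        (∫⁻ t in Ici x, μ (Ici t) ^ (r / (p - r)) * ν (Iic t) ^ ((p - 1) * r / (p - r)) ∂μ) ^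
          (q * (p - r) / (r * (p - q))) ∂ω := by
    rw [lintegral_withDensity_mu0 hw.1 ((mW.pow_const _).fun_mul
      ((measurable_setLIntegral_Ici _ _).pow_const _))]
    refine setLIntegral_congr_fun measurableSet_Ioi fun x hx => ?_
    rw [setLIntegral_Ici_withDensity_mu0 hu.1 ((mU.pow_const _).fun_mul (mV.pow_const _)) hx, hW,
      mul_right_comm]
    congr 3
    refine setLIntegral_congr_fun measurableSet_Ioi fun t ht => ?_
    rw [hU t (hx.trans ht), hV, mul_right_comm]
  rw [ENNReal.rpow_lt_top_iff_ne_top hs, ENNReal.rpow_lt_top_iff_ne_top hs, hF4, hF6,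
    ← iterated_hardy_iff hp hq hqp hr hrp hσ.chargesHalfLine hu.chargesHalfLine hw.chargesHalfLine
      hVt]
  have hL : ∀ f : ℝ → ℝ≥0∞, Measurable f →
      ∫⁻ x in Ioi (0 : ℝ),
        (∫⁻ t in Ioi x, (∫⁻ s in Ioc (0 : ℝ) t, f s * σ s) ^ r * u t) ^ (q / r) * w x =
      ∫⁻ x, (∫⁻ t in Ici x, (∫⁻ y in Iic t, f y ∂ν) ^ r ∂μ) ^ (q / r) ∂ω := fun f mf => by
    rw [lintegral_withDensity_mu0 hw.1 ((measurable_setLIntegral_Ici _ _).pow_const _)]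
    refine setLIntegral_congr_fun measurableSet_Ioi fun x hx => ?_
    rw [setLIntegral_Ici_withDensity_mu0 hu.1 ((measurable_setLIntegral_Iic _ _).pow_const _) hx]
    simp only [hν_def, setLIntegral_Iic_withDensity_mu0 hσ.1 mf]
  have hR : ∀ f : ℝ → ℝ≥0∞, Measurable f →
      ∫⁻ t in Ioi (0 : ℝ), (f t * σ t) ^ p * v t = ∫⁻ y, f y ^ p ∂ν := fun f mf => by
    rw [lintegral_withDensity_mu0 hσ.1 (mf.pow_const _)]
    refine lintegral_congr_ae (hv.2.mono fun x hx => ?_)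
    simp only
    rw [ENNReal.mul_rpow_of_nonneg _ _ hp0.le, mul_assoc,
      ENNReal.rpow_dual_mul_self hp hx.1.ne' hx.2.ne]
  constructor
  · rintro ⟨C, -, hC⟩
    refine ⟨(C : ℝ≥0∞) ^ q, ENNReal.rpow_ne_top_of_nonneg hq.le ENNReal.coe_ne_top, fun f mf => ?_⟩
    have h := hC _ (mf.fun_mul hσ.1)
    rw [hL f mf, hR f mf] at h
    have h' := ENNReal.rpow_le_rpow h hq.le
    rwa [← ENNReal.rpow_mul, one_div_mul_cancel hq.ne', ENNReal.rpow_one,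
      ENNReal.mul_rpow_of_nonneg _ _ hq.le, ← ENNReal.rpow_mul, one_div_mul_eq_div] at h'
  · rintro ⟨C, hCt, hC⟩
    have hD : (C + 1) ^ (1 / q) ≠ ∞ := ENNReal.rpow_ne_top_of_nonneg (by positivity)
      (ENNReal.add_ne_top.2 ⟨hCt, ENNReal.one_ne_top⟩)
    refine ⟨((C + 1) ^ (1 / q)).toNNReal, ENNReal.toNNReal_pos (by simp [hq.le]) hD, fun h mh => ?_⟩
    rw [ENNReal.coe_toNNReal hD]
    have mf : Measurable fun x => h x / σ x := mh.div hσ.1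
    have hae : ∀ᵐ x ∂(volume.restrict (Ioi (0 : ℝ))), h x = h x / σ x * σ x :=
      hσ.2.mono fun x hx => (ENNReal.div_mul_cancel hx.1.ne' hx.2.ne).symm
    have e1 : ∀ t, ∫⁻ s in Ioc (0 : ℝ) t, h s = ∫⁻ s in Ioc (0 : ℝ) t, h s / σ s * σ s := fun t =>
      lintegral_congr_ae (ae_restrict_of_ae_restrict_of_subset Ioc_subset_Ioi_self hae)
    have e2 : ∫⁻ t in Ioi (0 : ℝ), h t ^ p * v t =
        ∫⁻ t in Ioi (0 : ℝ), (h t / σ t * σ t) ^ p * v t :=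
      lintegral_congr_ae (hae.mono fun x hx => by simp only [← hx])
    simp only [e1]
    rw [e2, hL _ mf, hR _ mf]
    refine (ENNReal.rpow_le_rpow ((hC _ mf).trans (mul_le_mul_left (le_self_add (b := 1)) _))
      (by positivity)).trans_eq ?_
    rw [ENNReal.mul_rpow_of_nonneg _ _ (by positivity), ← ENNReal.rpow_mul]
    congr 2
    field_simp
end
end

section
/- Let 0 < q, r < ∞ and 1 < p < ∞ with p ≤ min{q, r}, let u, w be weights on (0,∞), and let v be a weight on (0,∞) such that ∫_x^∞ v(t)^{1-p'} dt < ∞ for every x ∈ (0,∞). Then there exists a constant C > 0 such that (∫₀^∞ (∫_x^∞ (∫_t^∞ h(s) ds)^r u(t) dt)^{q/r} w(x) dx)^{1/q} ≤ C (∫₀^∞ h(t)^p v(t) dt)^{1/p} for all h ∈ M⁺(0,∞) if and only if E₁ < ∞, where E₁ := sup_{t∈(0,∞)} (∫₀^t w(s) (∫_s^t u)^{q/r} ds)^{1/q} (∫_t^∞ v^{1-p'})^{1/p'}. -/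
open MeasureTheory Set ENNReal NNReal

noncomputable section

/-- The `ℓ^β` norm is dominated by the `ℓ^1` norm for `1 ≤ β`. -/
theorem ENNReal.tsum_rpow_le_rpow_tsum {ι : Type*} (a : ι → ℝ≥0∞) {β : ℝ} (hβ : 1 ≤ β) :
    ∑' k, a k ^ β ≤ (∑' k, a k) ^ β := by
  have split (x : ℝ≥0∞) : x ^ β = x * x ^ (β - 1) := by
    conv_lhs => rw [← add_sub_cancel 1 β]
    rw [ENNReal.rpow_add_of_nonneg _ _ zero_le_one (sub_nonneg.2 hβ), ENNReal.rpow_one]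
  simp_rw [split]
  rw [← ENNReal.tsum_mul_right]
  refine ENNReal.tsum_le_tsum fun k => ?_
  exact mul_le_mul_right (ENNReal.rpow_le_rpow (ENNReal.le_tsum k) (sub_nonneg.2 hβ)) _

/-- Countable subadditivity of `x ↦ x ^ α` for `0 < α ≤ 1`. -/
theorem ENNReal.rpow_tsum_le_tsum_rpow {ι : Type*} (a : ι → ℝ≥0∞) {α : ℝ} (h0 : 0 < α)
    (h1 : α ≤ 1) : (∑' k, a k) ^ α ≤ ∑' k, a k ^ α := by
  have h := ENNReal.tsum_rpow_le_rpow_tsum (fun k => a k ^ α) (one_le_inv_iff₀.2 ⟨h0, h1⟩)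
  simp only [ENNReal.rpow_rpow_inv h0.ne'] at h
  calc (∑' k, a k) ^ α ≤ ((∑' k, a k ^ α) ^ α⁻¹) ^ α := ENNReal.rpow_le_rpow h h0.le
    _ = _ := ENNReal.rpow_inv_rpow h0.ne' _

/-- Minkowski's inequality for countable sums. -/
theorem lintegral_Lp_tsum_le {X ι : Type*} [MeasurableSpace X] [Countable ι] {μ : Measure X}
    {f : ι → X → ℝ≥0∞} (hf : ∀ k, Measurable (f k)) {p : ℝ} (hp : 1 ≤ p) :
    (∫⁻ x, (∑' k, f k x) ^ p ∂μ) ^ (1 / p) ≤ ∑' k, (∫⁻ x, f k x ^ p ∂μ) ^ (1 / p) := by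
  have hp0 : 0 < p := zero_lt_one.trans_le hp
  have hmeas (s : Finset ι) : Measurable fun x => ∑ k ∈ s, f k x :=
    Finset.measurable_fun_sum s fun k _ => hf k
  have hfin (s : Finset ι) :
      (∫⁻ x, (∑ k ∈ s, f k x) ^ p ∂μ) ^ (1 / p) ≤ ∑ k ∈ s, (∫⁻ x, f k x ^ p ∂μ) ^ (1 / p) := by
    classical
    induction s using Finset.induction_on with
    | empty => simp [hp0]
    | insert k s hk ih =>
      simp only [Finset.sum_insert hk]
      exact (ENNReal.lintegral_Lp_add_le (hf k).aemeasurable (hmeas s).aemeasurable hp).trans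
        (by gcongr)
  have hsup : ∫⁻ x, (∑' k, f k x) ^ p ∂μ = ⨆ s : Finset ι, ∫⁻ x, (∑ k ∈ s, f k x) ^ p ∂μ := by
    rw [← lintegral_iSup_directed fun s => ((hmeas s).pow_const p).aemeasurable]
    · congr with x
      rw [ENNReal.tsum_eq_iSup_sum]
      exact (ENNReal.orderIsoRpow p hp0).map_iSup _
    · refine Monotone.directed_le fun s t hst x => ?_
      exact ENNReal.rpow_le_rpow (Finset.sum_le_sum_of_subset hst) hp0.le
  rw [hsup]
  refine ((ENNReal.orderIsoRpow (1 / p) (by positivity)).map_iSup _).trans_le ?_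
  exact iSup_le fun s => (hfin s).trans (ENNReal.sum_le_tsum s)

/-- Hölder's inequality in weighted form. -/
theorem lintegral_le_weighted_Lp_mul {X : Type*} [MeasurableSpace X] {μ : Measure X} {p : ℝ}
    (hp : 1 < p) {h v : X → ℝ≥0∞} (hh : Measurable h) (hv : Measurable v)
    (hv' : ∀ᵐ x ∂μ, 0 < v x ∧ v x < ∞) :
    ∫⁻ x, h x ∂μ ≤ (∫⁻ x, h x ^ p * v x ∂μ) ^ (1 / p) *
      (∫⁻ x, v x ^ (1 - p / (p - 1)) ∂μ) ^ ((p - 1) / p) := by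
  have hp0 : 0 < p := by linarith
  have hp1 : 0 < p - 1 := by linarith
  have hconj : p.HolderConjugate (p / (p - 1)) := Real.HolderConjugate.conjExponent hp
  have key := ENNReal.lintegral_mul_le_Lp_mul_Lq μ hconj
    (hh.mul (hv.pow_const (1 / p))).aemeasurable (hv.pow_const (-(1 / p))).aemeasurable
  convert key using 1
  · refine lintegral_congr_ae ?_
    filter_upwards [hv'] with x hx
    simp only [Pi.mul_apply]
    rw [mul_assoc, ← ENNReal.rpow_add _ _ hx.1.ne' hx.2.ne]
    simp
  · congr 2
    · refine lintegral_congr fun x => ?_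
      simp only [Pi.mul_apply]
      rw [ENNReal.mul_rpow_of_nonneg _ _ hp0.le, ← ENNReal.rpow_mul, one_div_mul_cancel hp0.ne',
        ENNReal.rpow_one]
    · refine lintegral_congr fun x => ?_
      rw [← ENNReal.rpow_mul]
      congr 1
      field_simp
      ring
    · rw [one_div_div]

/-- A finite tail integral depends continuously on its lower endpoint. -/
theorem continuousOn_setLIntegral_Ioi {f : ℝ → ℝ≥0∞} {a : ℝ} (h : ∫⁻ x in Ioi a, f x ≠ ∞) :
    ContinuousOn (fun t => ∫⁻ x in Ioi t, f x) (Ici a) := by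
  intro t ht
  have hvol : Filter.Tendsto ((volume.restrict (Ioi a)) ∘ fun s => uIoc t s)
      (nhdsWithin t (Ici a)) (nhds 0) := by
    have h0 : Filter.Tendsto (fun s => ENNReal.ofReal |s - t|) (nhds t) (nhds 0) := by
      have : ContinuousAt (fun s => ENNReal.ofReal |s - t|) t :=
        ENNReal.continuous_ofReal.continuousAt.comp (by fun_prop)
      simpa [ContinuousAt] using this
    refine tendsto_of_tendsto_of_tendsto_of_le_of_le tendsto_const_nhds
      (h0.mono_left nhdsWithin_le_nhds) (fun _ => zero_le) fun s => ?_
    refine (Measure.restrict_apply_le _ _).trans_eq ?_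
    simp [Real.volume_uIoc]
  have hG := tendsto_setLIntegral_zero h hvol
  have hle {x y : ℝ} (hx : a ≤ x) : ∫⁻ τ in Ioi x, f τ ≤
      (∫⁻ τ in Ioi y, f τ) + ∫⁻ τ in uIoc x y, f τ ∂(volume.restrict (Ioi a)) := by
    rw [Measure.restrict_restrict measurableSet_uIoc]
    refine (lintegral_mono_set fun τ hτ => ?_).trans (lintegral_union_le _ _ _)
    rcases lt_or_ge y τ with hy | hy
    · exact Or.inl hy
    · exact Or.inr ⟨mem_uIoc.2 (Or.inl ⟨hτ, hy⟩), lt_of_le_of_lt hx hτ⟩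
  have htop : ∫⁻ τ in Ioi t, f τ ≠ ∞ :=
    ne_top_of_le_ne_top h (lintegral_mono_set (Ioi_subset_Ioi ht))
  have hlow := ENNReal.Tendsto.sub (tendsto_const_nhds (x := ∫⁻ τ in Ioi t, f τ)) hG (Or.inl htop)
  have hupp := (tendsto_const_nhds (x := ∫⁻ τ in Ioi t, f τ)).add hG
  rw [tsub_zero] at hlow
  rw [add_zero] at hupp
  refine tendsto_of_tendsto_of_tendsto_of_le_of_le' hlow hupp ?_ ?_
  · exact Filter.Eventually.of_forall fun s => tsub_le_iff_right.2 (hle ht)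
  · filter_upwards [self_mem_nhdsWithin] with s hs
    simpa only [uIoc_comm] using hle (y := t) hs

theorem tendsto_setLIntegral_Ioi_atTop {f : ℝ → ℝ≥0∞} {a : ℝ} (h : ∫⁻ x in Ioi a, f x ≠ ∞) :
    Filter.Tendsto (fun t => ∫⁻ x in Ioi t, f x) Filter.atTop (nhds 0) := by
  have := tendsto_measure_iInter_atTop (μ := volume.withDensity f) (s := fun t : ℝ => Ioi t)
    (fun t => measurableSet_Ioi.nullMeasurableSet) (fun s t hst => Ioi_subset_Ioi hst)
    ⟨a, by rwa [withDensity_apply _ measurableSet_Ioi]⟩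
  have hempty : ⋂ t : ℝ, Ioi t = ∅ :=
    eq_empty_of_forall_notMem fun x hx => lt_irrefl x (mem_iInter.1 hx x)
  rw [hempty, measure_empty] at this
  refine this.congr fun t => ?_
  exact withDensity_apply _ measurableSet_Ioi

/-- The tail integral attains every positive value below its supremum. -/
theorem exists_setLIntegral_Ioi_eq {f : ℝ → ℝ≥0∞} {a : ℝ} (h : ∫⁻ x in Ioi a, f x ≠ ∞)
    {y : ℝ≥0∞} (hy : 0 < y) (hy' : y < ∫⁻ x in Ioi a, f x) :
    ∃ t, a ≤ t ∧ ∫⁻ x in Ioi t, f x = y := by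
  obtain ⟨b, hb, hab⟩ := (((tendsto_setLIntegral_Ioi_atTop h).eventually (gt_mem_nhds hy)).and
    (Filter.eventually_ge_atTop a)).exists
  obtain ⟨t, ht, hty⟩ := intermediate_value_Icc' hab
    ((continuousOn_setLIntegral_Ioi h).mono Icc_subset_Ici_self) ⟨hb.le, hy'.le⟩
  exact ⟨t, ht.1, hty⟩

theorem antitone_setLIntegral_Ioi (f : ℝ → ℝ≥0∞) : Antitone fun t => ∫⁻ x in Ioi t, f x :=
  fun _ _ hst => lintegral_mono_set (Ioi_subset_Ioi hst)

theorem two_zpow_add_one (k : ℤ) : (2 : ℝ≥0∞) ^ (k + 1) = 2 * 2 ^ k := by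
  rw [ENNReal.zpow_add two_ne_zero ofNat_ne_top, zpow_one, mul_comm]

/-- Dyadic decomposition of `x ^ r` over the powers of two below `x`. -/
theorem rpow_le_tsum_dyadic {r : ℝ} (hr : 0 < r) {x : ℝ≥0∞} (hx : x ≠ ∞) :
    x ^ r ≤ ∑' k : ℤ, ((2 : ℝ≥0∞) ^ (k + 1)) ^ r * {y : ℝ≥0∞ | 2 ^ k < y}.indicator 1 x := by
  rcases eq_or_ne x 0 with rfl | h0
  · simp [hr]
  obtain ⟨k, hk, hk'⟩ := ENNReal.exists_mem_Ioc_zpow h0 hx one_lt_two ofNat_ne_top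
  refine le_trans ?_ (ENNReal.le_tsum k)
  rw [indicator_of_mem (by exact hk), Pi.one_apply, mul_one]
  gcongr

/-- Countable subadditivity of a weighted `L^{q/r}` functional, with exponent `min q r`. -/
theorem weighted_norm_tsum_le {X ι : Type*} [MeasurableSpace X] [Countable ι] {μ : Measure X}
    {q r : ℝ} (hq : 0 < q) (hr : 0 < r) (c : ι → ℝ≥0∞) {U : ι → X → ℝ≥0∞}
    (hU : ∀ k, Measurable (U k)) :
    (∫⁻ x, (∑' k, c k ^ r * U k x) ^ (q / r) ∂μ) ^ (1 / q) ≤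
      (∑' k, (c k * (∫⁻ x, U k x ^ (q / r) ∂μ) ^ (1 / q)) ^ min q r) ^ (1 / min q r) := by
  have hqr : 0 < q / r := by positivity
  have hterm (k) : ∫⁻ x, (c k ^ r * U k x) ^ (q / r) ∂μ =
      c k ^ q * ∫⁻ x, U k x ^ (q / r) ∂μ := by
    rw [← lintegral_const_mul _ ((hU k).pow_const _)]
    refine lintegral_congr fun x => ?_
    rw [ENNReal.mul_rpow_of_nonneg _ _ hqr.le, ← ENNReal.rpow_mul, mul_div_cancel₀ _ hr.ne']
  rcases le_total q r with h | h
  · rw [min_eq_left h]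
    gcongr
    calc _ ≤ ∫⁻ x, ∑' k, (c k ^ r * U k x) ^ (q / r) ∂μ := by
          gcongr with x
          exact ENNReal.rpow_tsum_le_tsum_rpow _ hqr ((div_le_one hr).2 h)
      _ = ∑' k, ∫⁻ x, (c k ^ r * U k x) ^ (q / r) ∂μ :=
          lintegral_tsum fun k => (((hU k).const_mul _).pow_const _).aemeasurable
      _ ≤ _ := by
          gcongr with k
          rw [hterm, ENNReal.mul_rpow_of_nonneg _ _ hq.le, ← ENNReal.rpow_mul,
            one_div_mul_cancel hq.ne', ENNReal.rpow_one]
  · rw [min_eq_right h]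
    have := lintegral_Lp_tsum_le (μ := μ) (fun k => (hU k).const_mul (c k ^ r))
      ((one_le_div hr).2 h)
    calc _ = ((∫⁻ x, (∑' k, c k ^ r * U k x) ^ (q / r) ∂μ) ^ (1 / (q / r))) ^ (1 / r) := by
          rw [← ENNReal.rpow_mul]; congr 1; field_simp
      _ ≤ _ := by
          gcongr
          refine this.trans (ENNReal.tsum_le_tsum fun k => ?_)
          rw [hterm, ENNReal.mul_rpow_of_nonneg _ _ hr.le,
            ENNReal.mul_rpow_of_nonneg _ _ (by positivity), ← ENNReal.rpow_mul, ← ENNReal.rpow_mul]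
          gcongr ?_ * ?_
          · apply le_of_eq; congr 1; field_simp
          · apply le_of_eq; congr 1; field_simp

/-- The product at the point `t` whose supremum characterizes the iterated Hardy inequality. -/
def hardyQuantity (p q r : ℝ) (u w v : ℝ → ℝ≥0∞) (t : ℝ) : ℝ≥0∞ :=
  (∫⁻ s in Ioc (0 : ℝ) t, w s * (∫⁻ τ in Ioc s t, u τ) ^ (q / r)) ^ (1 / q) *
    (∫⁻ τ in Ioi t, v τ ^ (1 - p / (p - 1))) ^ ((p - 1) / p)

/-- A set lying to the left of `t` contributes at most the left-hand factor at `t`. -/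
theorem lintegral_indicator_left_le {α : ℝ} (hα : 0 < α) (u w : ℝ → ℝ≥0∞) {S : Set ℝ}
    (hS : MeasurableSet S) {t : ℝ} (ht : 0 ≤ t)
    (hSt : S ∩ Ioi 0 ⊆ Iic t) :
    ∫⁻ x in Ioi (0 : ℝ), w x * (∫⁻ τ in Ioi x, S.indicator u τ) ^ α ≤
      ∫⁻ s in Ioc (0 : ℝ) t, w s * (∫⁻ τ in Ioc s t, u τ) ^ α := by
  have hle {x : ℝ} (hx : 0 < x) : ∫⁻ τ in Ioi x, S.indicator u τ ≤ ∫⁻ τ in Ioc x t, u τ := by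
    rw [setLIntegral_indicator hS]
    exact lintegral_mono_set fun τ hτ => ⟨hτ.2, hSt ⟨hτ.1, hx.trans hτ.2⟩⟩
  calc _ ≤ ∫⁻ x in Ioc 0 t ∪ Ioi t, w x * (∫⁻ τ in Ioi x, S.indicator u τ) ^ α :=
        lintegral_mono_set Ioi_subset_Ioc_union_Ioi
    _ ≤ (∫⁻ x in Ioc 0 t, w x * (∫⁻ τ in Ioi x, S.indicator u τ) ^ α) +
        ∫⁻ x in Ioi t, w x * (∫⁻ τ in Ioi x, S.indicator u τ) ^ α := lintegral_union_le _ _ _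
    _ ≤ (∫⁻ s in Ioc (0 : ℝ) t, w s * (∫⁻ τ in Ioc s t, u τ) ^ α) + ∫⁻ x in Ioi t, 0 := by
        refine add_le_add (setLIntegral_mono' measurableSet_Ioc fun x hx => ?_)
          (setLIntegral_mono' measurableSet_Ioi fun x hx => ?_)
        · exact mul_le_mul_right (ENNReal.rpow_le_rpow (hle hx.1) hα.le) _
        · have := hle (ht.trans_lt hx)
          rw [Ioc_eq_empty (not_lt.2 (le_of_lt hx)), Measure.restrict_empty,
            lintegral_zero_measure, nonpos_iff_eq_zero] at this
          simp [this, hα]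
    _ = _ := by simp

/-- Estimate of one dyadic level of the tail integral of `h`. -/
theorem dyadic_level_le {p q r : ℝ} (hp : 1 < p) (hq : 0 < q) (hr : 0 < r) {u w v h : ℝ → ℝ≥0∞}
    (hv : Measurable v) (hv' : ∀ᵐ x ∂(volume.restrict (Ioi (0 : ℝ))), 0 < v x ∧ v x < ∞)
    (hh : Measurable h) {E : ℝ≥0∞} (hE : ∀ t > 0, hardyQuantity p q r u w v t ≤ E)
    {y : ℝ≥0∞} (hy : y ≠ ∞) {t s : ℝ} (ht : 0 < t) (hty : ∫⁻ x in Ioi t, h x = 2 * y)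
    (hsy : ∫⁻ x in Ioi s, h x = y) (hts : t ≤ s) :
    2 * (2 * y) * (∫⁻ x in Ioi (0 : ℝ), w x * (∫⁻ τ in Ioi x,
      {τ | 2 * y < ∫⁻ x in Ioi τ, h x}.indicator u τ) ^ (q / r)) ^ (1 / q) ≤
      4 * E * (∫⁻ x in Ioc t s, h x ^ p * v x) ^ (1 / p) := by
  have hp0 : 0 < p := by linarith
  have hp1 : 0 < p - 1 := by linarith
  have hsub : Ioc t s ⊆ Ioi 0 := fun x hx => ht.trans hx.1
  have hyI : y = ∫⁻ x in Ioc t s, h x := by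
    have := lintegral_union (μ := volume) (f := h) measurableSet_Ioi
      (Ioc_disjoint_Ioi (a := t) (le_refl s))
    rw [Ioc_union_Ioi_eq_Ioi hts, hty, hsy, two_mul] at this
    exact (ENNReal.add_left_inj hy).1 this
  have hHol := lintegral_le_weighted_Lp_mul (μ := volume.restrict (Ioc t s)) hp hh hv
    (ae_restrict_of_ae_restrict_of_subset hsub hv')
  rw [← hyI] at hHol
  have hS : MeasurableSet {τ | 2 * y < ∫⁻ x in Ioi τ, h x} :=
    measurableSet_lt measurable_const (antitone_setLIntegral_Ioi h).measurable
  have hleft := lintegral_indicator_left_le (div_pos hq hr) u w hS ht.le fun τ hτ => by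
    by_contra hlt
    exact absurd ((antitone_setLIntegral_Ioi h) (le_of_lt (not_le.1 hlt)))
      (not_le.2 (hty.trans_lt hτ.1))
  set D := ∫⁻ x in Ioi (0 : ℝ), w x * (∫⁻ τ in Ioi x,
      {τ | 2 * y < ∫⁻ x in Ioi τ, h x}.indicator u τ) ^ (q / r)
  calc 2 * (2 * y) * D ^ (1 / q) = 4 * (D ^ (1 / q) * y) := by ring
    _ ≤ 4 * ((∫⁻ s in Ioc (0 : ℝ) t, w s * (∫⁻ τ in Ioc s t, u τ) ^ (q / r)) ^ (1 / q) *
        ((∫⁻ x in Ioc t s, h x ^ p * v x) ^ (1 / p) *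
          (∫⁻ τ in Ioi t, v τ ^ (1 - p / (p - 1))) ^ ((p - 1) / p))) := by
        refine mul_le_mul_right (mul_le_mul' (by gcongr) (hHol.trans ?_)) _
        gcongr
        exact Ioc_subset_Ioi_self
    _ = 4 * hardyQuantity p q r u w v t * (∫⁻ x in Ioc t s, h x ^ p * v x) ^ (1 / p) := by
        rw [hardyQuantity]; ring
    _ ≤ _ := by gcongr; exact hE t ht

/-- Sufficiency of the supremum condition. -/
theorem iterated_hardy_le {p q r : ℝ} (hp : 1 < p) (hq : 0 < q) (hr : 0 < r)
    (hpq : p ≤ q) (hpr : p ≤ r) {u w v h : ℝ → ℝ≥0∞} (hu : Measurable u) (hw : Measurable w)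
    (hv : Measurable v) (hv' : ∀ᵐ x ∂(volume.restrict (Ioi (0 : ℝ))), 0 < v x ∧ v x < ∞)
    (hh : Measurable h) {E : ℝ≥0∞} (hE : ∀ t > 0, hardyQuantity p q r u w v t ≤ E)
    (hfin : ∀ t > 0, ∫⁻ s in Ioi t, h s ≠ ∞) :
    (∫⁻ x in Ioi (0 : ℝ),
      (∫⁻ t in Ioi x, (∫⁻ s in Ioi t, h s) ^ r * u t) ^ (q / r) * w x) ^ (1 / q) ≤
      4 * E * (∫⁻ t in Ioi (0 : ℝ), h t ^ p * v t) ^ (1 / p) := by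
  have hp0 : 0 < p := by linarith
  set H : ℝ → ℝ≥0∞ := fun t => ∫⁻ s in Ioi t, h s
  have hHanti : Antitone H := antitone_setLIntegral_Ioi h
  set S : ℤ → Set ℝ := fun k => {τ | 2 ^ k < H τ}
  have hS (k) : MeasurableSet (S k) := measurableSet_lt measurable_const hHanti.measurable
  set U : ℤ → ℝ → ℝ≥0∞ := fun k x => ∫⁻ τ in Ioi x, (S k).indicator u τ with hUdef
  have hU (k) : Measurable (U k) := (antitone_setLIntegral_Ioi _).measurable
  set K : Set ℤ := {k | ∃ t > 0, 2 ^ k < H t}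
  have hK {k : ℤ} (hk : k ∈ K) : k - 1 ∈ K := by
    obtain ⟨t, ht, hkt⟩ := hk
    exact ⟨t, ht, (ENNReal.zpow_le_of_le one_le_two (by omega)).trans_lt hkt⟩
  have hex (k : ℤ) : ∃ t : ℝ, k ∈ K → 0 < t ∧ H t = 2 ^ k := by
    by_cases hk : k ∈ K
    · obtain ⟨a, ha, hka⟩ := hk
      obtain ⟨t, hat, ht⟩ := exists_setLIntegral_Ioi_eq (hfin a ha)
        (ENNReal.zpow_pos two_ne_zero ofNat_ne_top k) hka
      exact ⟨t, fun _ => ⟨lt_of_lt_of_le ha hat, ht⟩⟩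
    · exact ⟨0, fun h => absurd h hk⟩
  choose T hT using hex
  have hTanti {k l : ℤ} (hk : k ∈ K) (hl : l ∈ K) (hkl : k < l) : T l ≤ T k := by
    by_contra! hlt
    have h1 := hHanti hlt.le
    rw [(hT k hk).2, (hT l hl).2] at h1
    have h2 : (2 : ℝ≥0∞) ^ (k + 1) ≤ 2 ^ k :=
      (ENNReal.zpow_le_of_le one_le_two (by omega)).trans h1
    rw [two_zpow_add_one, two_mul] at h2
    exact (ENNReal.lt_add_right (ENNReal.zpow_ne_top two_ne_zero ofNat_ne_top k)
      (ENNReal.zpow_pos two_ne_zero ofNat_ne_top k).ne').not_ge h2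
  set B : ℤ → Set ℝ := fun k => {τ | k ∈ K ∧ τ ∈ Ioc (T k) (T (k - 1))} with hBdef
  have hBmeas (k) : MeasurableSet (B k) := (MeasurableSet.const _).inter measurableSet_Ioc
  have hBpos (k) : B k ⊆ Ioi 0 := fun τ hτ => (hT k hτ.1).1.trans hτ.2.1
  have hBdisj : Pairwise (Function.onFun Disjoint B) := by
    refine (pairwise_disjoint_on B).2 fun k l hkl => disjoint_left.2 fun τ hk hl => ?_
    have : T (l - 1) ≤ T k := by
      rcases eq_or_lt_of_le (show k ≤ l - 1 by omega) with h | h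
      · rw [h]
      · exact hTanti hk.1 (hK hl.1) h
    exact (hk.2.1.trans_le (hl.2.2.trans this)).false
  set ν := (volume.restrict (Ioi (0 : ℝ))).withDensity w
  have hνint {f : ℝ → ℝ≥0∞} (hf : Measurable f) :
      ∫⁻ x, f x ∂ν = ∫⁻ x in Ioi (0 : ℝ), w x * f x :=
    lintegral_withDensity_eq_lintegral_mul _ hw hf
  have hlevel (k : ℤ) : (2 : ℝ≥0∞) ^ (k + 1) * (∫⁻ x, U k x ^ (q / r) ∂ν) ^ (1 / q) ≤
      4 * E * (∫⁻ x in B k, h x ^ p * v x) ^ (1 / p) := by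
    rw [hνint ((hU k).pow_const _)]
    by_cases hk : k ∈ K
    · have hB : B k = Ioc (T k) (T (k - 1)) := by ext; simp [hBdef, hk]
      have h2 : (2 : ℝ≥0∞) ^ k = 2 * 2 ^ (k - 1) := by
        rw [← two_zpow_add_one, sub_add_cancel]
      have := dyadic_level_le hp hq hr hv hv' hh hE
        (ENNReal.zpow_ne_top two_ne_zero ofNat_ne_top (k - 1)) (hT k hk).1
        (by rw [← h2]; exact (hT k hk).2) (hT _ (hK hk)).2 (hTanti (hK hk) hk (by omega))
      rw [← h2, ← two_zpow_add_one] at this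
      rw [hB]
      exact this
    · have h0 := lintegral_indicator_left_le (div_pos hq hr) u w (hS k) le_rfl
        (fun τ hτ => absurd ⟨τ, hτ.2, hτ.1⟩ hk)
      simp only [Ioc_self, Measure.restrict_empty, lintegral_zero_measure,
        nonpos_iff_eq_zero] at h0
      simp only [hUdef]
      rw [h0]
      simp [hq]
  have hpoint {x : ℝ} (hx : 0 < x) : ∫⁻ t in Ioi x, H t ^ r * u t ≤
      ∑' k : ℤ, ((2 : ℝ≥0∞) ^ (k + 1)) ^ r * U k x := by
    calc _ ≤ ∫⁻ t in Ioi x, ∑' k : ℤ, ((2 : ℝ≥0∞) ^ (k + 1)) ^ r * (S k).indicator u t := by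
          refine setLIntegral_mono' measurableSet_Ioi fun t ht => ?_
          refine (mul_le_mul_left (rpow_le_tsum_dyadic hr (hfin t (hx.trans ht))) _).trans_eq ?_
          rw [← ENNReal.tsum_mul_right]
          refine tsum_congr fun k => ?_
          by_cases hk : (2 : ℝ≥0∞) ^ k < H t
          · simp [S, H, hk, indicator]
          · simp [S, H, hk, indicator]
      _ = _ := by
          rw [lintegral_tsum fun k => ((hu.indicator (hS k)).const_mul _).aemeasurable]
          exact tsum_congr fun k => lintegral_const_mul _ (hu.indicator (hS k))
  have hm : p ≤ min q r := le_min hpq hpr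
  have hm0 : 0 < min q r := hp0.trans_le hm
  calc _ ≤ (∫⁻ x, (∑' k : ℤ, ((2 : ℝ≥0∞) ^ (k + 1)) ^ r * U k x) ^ (q / r) ∂ν) ^ (1 / q) := by
        refine ENNReal.rpow_le_rpow ?_ (by positivity)
        rw [hνint ((Measurable.tsum fun k => (hU k).const_mul _).pow_const _)]
        refine setLIntegral_mono' measurableSet_Ioi fun x hx => ?_
        rw [mul_comm]
        gcongr
        exact hpoint hx
    _ ≤ (∑' k : ℤ, ((2 : ℝ≥0∞) ^ (k + 1) * (∫⁻ x, U k x ^ (q / r) ∂ν) ^ (1 / q)) ^ min q r) ^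
        (1 / min q r) := weighted_norm_tsum_le hq hr _ hU
    _ ≤ (∑' k : ℤ, (4 * E * (∫⁻ x in B k, h x ^ p * v x) ^ (1 / p)) ^ min q r) ^
        (1 / min q r) := by
        refine ENNReal.rpow_le_rpow (ENNReal.tsum_le_tsum fun k => ?_) (by positivity)
        exact ENNReal.rpow_le_rpow (hlevel k) hm0.le
    _ = 4 * E * (∑' k : ℤ, (∫⁻ x in B k, h x ^ p * v x) ^ (min q r / p)) ^ (1 / min q r) := by
        simp_rw [ENNReal.mul_rpow_of_nonneg (4 * E) _ hm0.le]
        rw [ENNReal.tsum_mul_left, ENNReal.mul_rpow_of_nonneg _ _ (by positivity),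
          ← ENNReal.rpow_mul, mul_one_div_cancel hm0.ne', ENNReal.rpow_one]
        simp_rw [← ENNReal.rpow_mul, one_div_mul_eq_div]
    _ ≤ 4 * E * ((∑' k : ℤ, ∫⁻ x in B k, h x ^ p * v x) ^ (min q r / p)) ^ (1 / min q r) := by
        gcongr
        exact ENNReal.tsum_rpow_le_rpow_tsum _ ((one_le_div hp0).2 hm)
    _ = 4 * E * (∫⁻ x in ⋃ k, B k, h x ^ p * v x) ^ (1 / p) := by
        rw [lintegral_iUnion hBmeas hBdisj, ← ENNReal.rpow_mul]
        congr 2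
        field_simp
    _ ≤ _ := by
        gcongr
        exact iUnion_subset hBpos

/-- Necessity of the supremum condition. -/
theorem hardyQuantity_le_of_iterated_hardy {p q r : ℝ} (hp : 1 < p) (hq : 0 < q) (hr : 0 < r)
    {u w v : ℝ → ℝ≥0∞}
    (hv : Measurable v) (hv' : ∀ᵐ x ∂(volume.restrict (Ioi (0 : ℝ))), 0 < v x ∧ v x < ∞)
    {C : ℝ≥0∞} (hC : ∀ h : ℝ → ℝ≥0∞, Measurable h →
        (∫⁻ x in Ioi (0 : ℝ),
            (∫⁻ t in Ioi x, (∫⁻ s in Ioi t, h s) ^ r * u t) ^ (q / r) * w x) ^ (1 / q) ≤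
          C * (∫⁻ t in Ioi (0 : ℝ), h t ^ p * v t) ^ (1 / p))
    {t : ℝ} (ht : 0 < t) (hfin : ∫⁻ τ in Ioi t, v τ ^ (1 - p / (p - 1)) ≠ ∞) :
    hardyQuantity p q r u w v t ≤ C := by
  have hp0 : 0 < p := by linarith
  have hp1 : 0 < p - 1 := by linarith
  have hqr : 0 < q / r := div_pos hq hr
  have hvt := ae_restrict_of_ae_restrict_of_subset (Ioi_subset_Ioi ht.le) hv'
  set g : ℝ → ℝ≥0∞ := fun τ => v τ ^ (1 - p / (p - 1)) with hg
  have hgm : Measurable g := hv.pow_const _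
  set V := ∫⁻ τ in Ioi t, g τ with hV
  have hV0 : V ≠ 0 := by
    intro h0
    rw [hV, lintegral_eq_zero_iff hgm] at h0
    have : ∀ᵐ x ∂(volume.restrict (Ioi t)), False := by
      filter_upwards [h0, hvt] with x hx hvx
      exact (ENNReal.rpow_pos hvx.1 hvx.2.ne).ne' hx
    rw [Filter.eventually_false_iff_eq_bot, ae_eq_bot, Measure.restrict_eq_zero] at this
    simp at this
  have key := hC ((Ioi t).indicator g) (hgm.indicator measurableSet_Ioi)
  have hright : ∫⁻ x in Ioi (0 : ℝ), (Ioi t).indicator g x ^ p * v x = V := by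
    have (x : ℝ) : (Ioi t).indicator g x ^ p * v x =
        (Ioi t).indicator (fun x => g x ^ p * v x) x := by
      by_cases hx : x ∈ Ioi t <;> simp [hx, hp0]
    simp_rw [this]
    rw [setLIntegral_indicator measurableSet_Ioi, inter_eq_left.2 (Ioi_subset_Ioi ht.le)]
    refine lintegral_congr_ae ?_
    filter_upwards [hvt] with x hx
    simp only [hg]
    rw [← ENNReal.rpow_mul]
    nth_rw 2 [← ENNReal.rpow_one (v x)]
    rw [← ENNReal.rpow_add _ _ hx.1.ne' hx.2.ne]
    congr 1
    field_simp
    ring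
  have hinner {s : ℝ} (hs : s ≤ t) : ∫⁻ τ in Ioi s, (Ioi t).indicator g τ = V := by
    rw [setLIntegral_indicator measurableSet_Ioi, inter_eq_left.2 (Ioi_subset_Ioi hs)]
  set A := ∫⁻ s in Ioc (0 : ℝ) t, w s * (∫⁻ τ in Ioc s t, u τ) ^ (q / r) with hA
  have hleft : V ^ q * A ≤ ∫⁻ x in Ioi (0 : ℝ), (∫⁻ τ in Ioi x,
      (∫⁻ s in Ioi τ, (Ioi t).indicator g s) ^ r * u τ) ^ (q / r) * w x := by
    rw [hA, ← lintegral_const_mul' _ _ (ENNReal.rpow_ne_top_of_nonneg hq.le hfin)]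
    refine le_trans (setLIntegral_mono' measurableSet_Ioc fun x hx => ?_)
      (lintegral_mono_set Ioc_subset_Ioi_self)
    have hVr : V ^ r * ∫⁻ τ in Ioc x t, u τ ≤ ∫⁻ τ in Ioi x,
        (∫⁻ s in Ioi τ, (Ioi t).indicator g s) ^ r * u τ := by
      rw [← lintegral_const_mul' _ _ (ENNReal.rpow_ne_top_of_nonneg hr.le hfin)]
      refine le_trans (setLIntegral_mono' measurableSet_Ioc fun τ hτ => ?_)
        (lintegral_mono_set Ioc_subset_Ioi_self)
      rw [hinner hτ.2]
    calc V ^ q * (w x * (∫⁻ τ in Ioc x t, u τ) ^ (q / r))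
        = (V ^ r * ∫⁻ τ in Ioc x t, u τ) ^ (q / r) * w x := by
          rw [ENNReal.mul_rpow_of_nonneg _ _ hqr.le, ← ENNReal.rpow_mul, mul_div_cancel₀ _ hr.ne']
          ring
      _ ≤ _ := by gcongr
  have hmain : V * A ^ (1 / q) ≤ C * V ^ (1 / p) := by
    calc V * A ^ (1 / q) = (V ^ q * A) ^ (1 / q) := by
          rw [ENNReal.mul_rpow_of_nonneg _ _ (by positivity), ← ENNReal.rpow_mul,
            mul_one_div_cancel hq.ne', ENNReal.rpow_one]
      _ ≤ _ := ENNReal.rpow_le_rpow hleft (by positivity)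
      _ ≤ _ := key
      _ = _ := by rw [hright]
  have hsplit : V = V ^ (1 / p) * V ^ ((p - 1) / p) := by
    rw [← ENNReal.rpow_add _ _ hV0 hfin, ← add_div, add_sub_cancel, div_self hp0.ne',
      ENNReal.rpow_one]
  refine (ENNReal.mul_le_mul_iff_left (c := V ^ (1 / p))
    (ENNReal.rpow_pos (pos_iff_ne_zero.2 hV0) hfin).ne'
    (ENNReal.rpow_ne_top_of_nonneg (by positivity) hfin)).1 ?_
  calc hardyQuantity p q r u w v t * V ^ (1 / p)
      = (V ^ (1 / p) * V ^ ((p - 1) / p)) * A ^ (1 / q) := by rw [hardyQuantity]; ring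
    _ ≤ _ := by rw [← hsplit]; exact hmain

theorem statement16 (p q r : ℝ) (hq : 0 < q) (hr : 0 < r) (hp : 1 < p) (hpq : p ≤ q) (hpr : p ≤ r)
    (u w v : ℝ → ℝ≥0∞) (hu : IsWeight u) (hw : IsWeight w) (hv : IsWeight v)
    (hvfin : ∀ x ∈ Ioi (0 : ℝ), (∫⁻ t in Ioi x, v t ^ (1 - p / (p - 1))) < ∞) :
    (∃ C : ℝ≥0, 0 < C ∧ ∀ h : ℝ → ℝ≥0∞, Measurable h →
        (∫⁻ x in Ioi (0 : ℝ),
            (∫⁻ t in Ioi x, (∫⁻ s in Ioi t, h s) ^ r * u t) ^ (q / r) * w x) ^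
          (1 / q) ≤
          (C : ℝ≥0∞) * (∫⁻ t in Ioi (0 : ℝ), h t ^ p * v t) ^ (1 / p)) ↔
      ((⨆ t ∈ Ioi (0 : ℝ),
        (∫⁻ s in Ioc (0 : ℝ) t, w s * (∫⁻ τ in Ioc s t, u τ) ^ (q / r)) ^ (1 / q) *
          (∫⁻ τ in Ioi t, v τ ^ (1 - p / (p - 1))) ^ ((p - 1) / p)) < ∞) := by
  have hp0 : 0 < p := by linarith
  constructor
  · rintro ⟨C, -, hC⟩
    refine lt_of_le_of_lt (iSup₂_le fun t ht => ?_) (ENNReal.coe_lt_top (r := C))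
    exact hardyQuantity_le_of_iterated_hardy hp hq hr hv.1 hv.2 hC ht (hvfin t ht).ne
  · intro hE
    set E := ⨆ t ∈ Ioi (0 : ℝ), hardyQuantity p q r u w v t
    have hEfin : 4 * E ≠ ∞ := ENNReal.mul_ne_top ofNat_ne_top hE.ne
    refine ⟨(4 * E).toNNReal + 1, by positivity, fun h hh => ?_⟩
    by_cases htop : ∫⁻ t in Ioi (0 : ℝ), h t ^ p * v t = ∞
    · rw [htop, ENNReal.top_rpow_of_pos (by positivity), ENNReal.mul_top (by simp)]
      exact le_top
    have hfin (t : ℝ) (ht : t > 0) : ∫⁻ s in Ioi t, h s ≠ ∞ := by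
      refine ne_top_of_le_ne_top (ENNReal.mul_ne_top ?_ ?_)
        (lintegral_le_weighted_Lp_mul hp hh hv.1
          (ae_restrict_of_ae_restrict_of_subset (Ioi_subset_Ioi ht.le) hv.2))
      · exact ENNReal.rpow_ne_top_of_nonneg (by positivity)
          (ne_top_of_le_ne_top htop (lintegral_mono_set (Ioi_subset_Ioi ht.le)))
      · exact ENNReal.rpow_ne_top_of_nonneg (div_nonneg (by linarith) hp0.le) (hvfin t ht).ne
    refine (iterated_hardy_le hp hq hr hpq hpr hu.1 hw.1 hv.1 hv.2 hh
      (fun t ht => le_iSup₂ (f := fun t (_ : t ∈ Ioi (0 : ℝ)) => hardyQuantity p q r u w v t) t ht)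
      hfin).trans ?_
    gcongr
    rw [ENNReal.coe_add, ENNReal.coe_toNNReal hEfin]
    exact le_self_add
end
end
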